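/- There exists a constant C > 0, depending only on T, α, β, K and δ, such that for every classical solution (v,u,θ,w,b) of the planar compressible MHD system on ℝ × [0,T] with (K,δ)-admissible initial data, one has ∫₀^T ∫_ℝ ( u_x² + θ^{−1} θ_x² ) dx dt ≤ C. -/

import Mathlib

open MeasureTheory Set Filter

noncomputable section

/-- Viscosity function `μ(z) = 1 + α z^(−α)` (here `μ̃₁ = 1`, `μ̃₂ = α`). -/
def visc (α z : ℝ) : ℝ := 1 + α * z ^ (-α)

/-- Squared Euclidean norm on `ℝ × ℝ` (used for the transverse fields `w, b ∈ ℝ²`). -/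
def sq2 (p : ℝ × ℝ) : ℝ := p.1 ^ 2 + p.2 ^ 2

/-- Partial derivative with respect to the first (spatial) variable. -/
def pdx {E : Type*} [NormedAddCommGroup E] [NormedSpace ℝ E]
    (f : ℝ → ℝ → E) (x t : ℝ) : E := deriv (fun y => f y t) x

/-- Partial derivative with respect to the second (time) variable, taken within `[0, T]`
(so it is one-sided at the endpoints). -/
def pdt (T : ℝ) {E : Type*} [NormedAddCommGroup E] [NormedSpace ℝ E]
    (f : ℝ → ℝ → E) (x t : ℝ) : E := derivWithin (fun s => f x s) (Icc 0 T) t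

/-- A classical solution of the planar compressible MHD system (in Lagrangian coordinates,
with all physical constants normalized to `1` and `μ̃₂ = α`) on `ℝ × [0,T]`:
all the derivatives appearing in the equations exist and are continuous, `v, θ > 0`,
the five equations hold pointwise, the solution tends to `(1,0,1,0,0)` as `|x| → ∞`
uniformly in `t ∈ [0,T]`, and `v−1, u, θ−1, b, w` and their first spatial derivatives
are square-integrable in `x` for each `t ∈ [0,T]`. -/
structure IsClassicalSolution (α β T : ℝ) (v u θ : ℝ → ℝ → ℝ)
    (w b : ℝ → ℝ → ℝ × ℝ) : Prop where
  v_pos : ∀ x : ℝ, ∀ t ∈ Icc (0:ℝ) T, 0 < v x t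
  θ_pos : ∀ x : ℝ, ∀ t ∈ Icc (0:ℝ) T, 0 < θ x t
  diff_x : ∀ x : ℝ, ∀ t ∈ Icc (0:ℝ) T,
    DifferentiableAt ℝ (fun y => v y t) x ∧ DifferentiableAt ℝ (fun y => u y t) x ∧
    DifferentiableAt ℝ (fun y => θ y t) x ∧ DifferentiableAt ℝ (fun y => w y t) x ∧
    DifferentiableAt ℝ (fun y => b y t) x
  diff_xx : ∀ x : ℝ, ∀ t ∈ Icc (0:ℝ) T,
    DifferentiableAt ℝ (fun y => pdx u y t) x ∧ DifferentiableAt ℝ (fun y => pdx θ y t) x ∧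
    DifferentiableAt ℝ (fun y => pdx w y t) x ∧ DifferentiableAt ℝ (fun y => pdx b y t) x
  diff_t : ∀ x : ℝ, ∀ t ∈ Icc (0:ℝ) T,
    DifferentiableWithinAt ℝ (fun s => v x s) (Icc 0 T) t ∧
    DifferentiableWithinAt ℝ (fun s => u x s) (Icc 0 T) t ∧
    DifferentiableWithinAt ℝ (fun s => θ x s) (Icc 0 T) t ∧
    DifferentiableWithinAt ℝ (fun s => w x s) (Icc 0 T) t ∧
    DifferentiableWithinAt ℝ (fun s => b x s) (Icc 0 T) t
  cont : ContinuousOn (fun p : ℝ × ℝ =>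
      (v p.1 p.2, u p.1 p.2, θ p.1 p.2, w p.1 p.2, b p.1 p.2)) (univ ×ˢ Icc 0 T)
  cont_dx : ContinuousOn (fun p : ℝ × ℝ =>
      (pdx v p.1 p.2, pdx u p.1 p.2, pdx θ p.1 p.2, pdx w p.1 p.2, pdx b p.1 p.2))
      (univ ×ˢ Icc 0 T)
  cont_dxx : ContinuousOn (fun p : ℝ × ℝ =>
      (pdx (pdx u) p.1 p.2, pdx (pdx θ) p.1 p.2, pdx (pdx w) p.1 p.2, pdx (pdx b) p.1 p.2))
      (univ ×ˢ Icc 0 T)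
  cont_dt : ContinuousOn (fun p : ℝ × ℝ =>
      (pdt T v p.1 p.2, pdt T u p.1 p.2, pdt T θ p.1 p.2, pdt T w p.1 p.2, pdt T b p.1 p.2))
      (univ ×ˢ Icc 0 T)
  eq_mass : ∀ x : ℝ, ∀ t ∈ Icc (0:ℝ) T, pdt T v x t = pdx u x t
  eq_mom : ∀ x : ℝ, ∀ t ∈ Icc (0:ℝ) T,
    pdt T u x t + pdx (fun y s => θ y s / v y s + sq2 (b y s) / 2) x t
      = pdx (fun y s => visc α (v y s) * pdx u y s / v y s) x t
  eq_w : ∀ x : ℝ, ∀ t ∈ Icc (0:ℝ) T,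
    pdt T w x t - pdx b x t = pdx (fun y s => (v y s)⁻¹ • pdx w y s) x t
  eq_b : ∀ x : ℝ, ∀ t ∈ Icc (0:ℝ) T,
    pdt T (fun y s => v y s • b y s) x t - pdx w x t
      = pdx (fun y s => (v y s)⁻¹ • pdx b y s) x t
  eq_temp : ∀ x : ℝ, ∀ t ∈ Icc (0:ℝ) T,
    pdt T θ x t + θ x t / v x t * pdx u x t
      = pdx (fun y s => θ y s ^ β * pdx θ y s / v y s) x t
        + (visc α (v x t) * pdx u x t ^ 2 + sq2 (pdx w x t) + sq2 (pdx b x t)) / v x t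
  farfield : ∀ ε > (0:ℝ), ∃ M : ℝ, ∀ x : ℝ, ∀ t ∈ Icc (0:ℝ) T, M ≤ |x| →
    |v x t - 1| < ε ∧ |u x t| < ε ∧ |θ x t - 1| < ε ∧
    Real.sqrt (sq2 (b x t)) < ε ∧ Real.sqrt (sq2 (w x t)) < ε
  sq_int : ∀ t ∈ Icc (0:ℝ) T,
    Integrable (fun x => (v x t - 1) ^ 2) ∧ Integrable (fun x => (u x t) ^ 2) ∧
    Integrable (fun x => (θ x t - 1) ^ 2) ∧ Integrable (fun x => sq2 (b x t)) ∧
    Integrable (fun x => sq2 (w x t)) ∧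
    Integrable (fun x => (pdx v x t) ^ 2) ∧ Integrable (fun x => (pdx u x t) ^ 2) ∧
    Integrable (fun x => (pdx θ x t) ^ 2) ∧ Integrable (fun x => sq2 (pdx b x t)) ∧
    Integrable (fun x => sq2 (pdx w x t))

/-- The initial data of a solution are `(K, δ)`-admissible: the `H¹`-type norm of
`(v₀−1, u₀, θ₀−1, b₀, w₀)` is at most `K²` and `v₀ ≥ δ`, `θ₀ ≥ δ`. -/
def Admissible (K δ : ℝ) (v u θ : ℝ → ℝ → ℝ) (w b : ℝ → ℝ → ℝ × ℝ) : Prop :=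
  (∫ x : ℝ, ((v x 0 - 1) ^ 2 + (u x 0) ^ 2 + (θ x 0 - 1) ^ 2 + sq2 (b x 0) + sq2 (w x 0)
      + (pdx v x 0) ^ 2 + (pdx u x 0) ^ 2 + (pdx θ x 0) ^ 2
      + sq2 (pdx b x 0) + sq2 (pdx w x 0))) ≤ K ^ 2 ∧
  (∀ x : ℝ, δ ≤ v x 0) ∧ (∀ x : ℝ, δ ≤ θ x 0)

/-! ### One-variable inequalities -/

/-- Relative entropy `∫₁ᶻ (1 - s⁻ᵖ) ds`. -/
def relEnt (p z : ℝ) : ℝ := ∫ s in (1:ℝ)..z, (1 - s ^ (-p))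

theorem uIcc_one_subset_Ioi {z : ℝ} (hz : 0 < z) : uIcc 1 z ⊆ Ioi (0:ℝ) := fun _ hs =>
  lt_of_lt_of_le (lt_min one_pos hz) hs.1

theorem continuousOn_relEnt_integrand (p : ℝ) :
    ContinuousOn (fun s : ℝ => 1 - s ^ (-p)) (Ioi 0) :=
  continuousOn_const.sub (continuousOn_id.rpow_const fun _ hx => Or.inl (ne_of_gt hx))

theorem hasDerivAt_relEnt (p : ℝ) {z : ℝ} (hz : 0 < z) :
    HasDerivAt (relEnt p) (1 - z ^ (-p)) z := by
  have hc := continuousOn_relEnt_integrand p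
  refine intervalIntegral.integral_hasDerivAt_right
    ((hc.mono (uIcc_one_subset_Ioi hz)).intervalIntegrable) ?_
    (hc.continuousAt (Ioi_mem_nhds hz))
  exact hc.stronglyMeasurableAtFilter isOpen_Ioi z hz

theorem continuousOn_relEnt (p : ℝ) : ContinuousOn (relEnt p) (Ioi 0) := fun _ hz =>
  (hasDerivAt_relEnt p hz).continuousAt.continuousWithinAt

theorem relEnt_nonneg {p z : ℝ} (hp : 0 ≤ p) (hz : 0 < z) : 0 ≤ relEnt p z := by
  rcases le_total 1 z with h | h
  · refine intervalIntegral.integral_nonneg h fun s hs => ?_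
    have := Real.rpow_le_one_of_one_le_of_nonpos hs.1 (neg_nonpos.2 hp)
    linarith
  · rw [relEnt, intervalIntegral.integral_symm, ← intervalIntegral.integral_neg]
    refine intervalIntegral.integral_nonneg h fun s hs => ?_
    have := Real.one_le_rpow_of_pos_of_le_one_of_nonpos (hz.trans_le hs.1) hs.2 (neg_nonpos.2 hp)
    linarith

theorem relEnt_one {z : ℝ} (hz : 0 < z) : relEnt 1 z = z - 1 - Real.log z := by
  have hi : ∫ s in (1:ℝ)..z, s⁻¹ = Real.log z := by
    rw [integral_inv_of_pos one_pos hz, div_one]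
  have h : relEnt 1 z = ∫ s in (1:ℝ)..z, (1 - s⁻¹) := by
    simp only [relEnt, Real.rpow_neg_one]
  rw [h, intervalIntegral.integral_sub (by simp), hi]
  · simp
  · refine ContinuousOn.intervalIntegrable (continuousOn_id.inv₀ fun s hs => ?_)
    exact ne_of_gt (uIcc_one_subset_Ioi hz hs)

theorem relEnt_of_ne_one {p z : ℝ} (hp : p ≠ 1) (hz : 0 < z) :
    relEnt p z = z - 1 - (z ^ (1 - p) - 1) / (1 - p) := by
  have h0 : (0:ℝ) ∉ uIcc 1 z := fun h =>
    lt_irrefl (0:ℝ) (uIcc_one_subset_Ioi hz h)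
  have hp' : -p ≠ -1 := fun h => hp (by linarith)
  rw [relEnt, intervalIntegral.integral_sub (by simp)
    (intervalIntegral.intervalIntegrable_rpow (Or.inr h0)), integral_rpow (Or.inr ⟨hp', h0⟩)]
  simp [neg_add_eq_sub]

theorem abs_rpow_sub_one_le {q δ z : ℝ} (hq : q ≤ 1) (hδ : 0 < δ) (hδ1 : δ ≤ 1) (hz : δ ≤ z) :
    |z ^ q - 1| ≤ |q| * δ ^ (q - 1) * |z - 1| := by
  have h := (convex_Ici δ).norm_image_sub_le_of_norm_hasDerivWithin_le
    (f := fun x : ℝ => x ^ q) (f' := fun x => q * x ^ (q - 1)) (C := |q| * δ ^ (q - 1))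
    (fun _ hx => (Real.hasDerivAt_rpow_const
      (Or.inl (ne_of_gt (hδ.trans_le hx)))).hasDerivWithinAt)
    (fun _ hx => by
      rw [Real.norm_eq_abs, abs_mul, abs_of_pos (Real.rpow_pos_of_pos (hδ.trans_le hx) _)]
      exact mul_le_mul_of_nonneg_left
        (Real.rpow_le_rpow_of_nonpos hδ hx (by linarith)) (abs_nonneg _))
    (x := 1) (y := z) hδ1 hz
  simpa [Real.norm_eq_abs] using h

theorem relEnt_le_sq {p δ z : ℝ} (hp : 0 ≤ p) (hδ : 0 < δ) (hδ1 : δ ≤ 1) (hz : δ ≤ z) :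
    relEnt p z ≤ p * δ ^ (-p - 1) * (z - 1) ^ 2 := by
  have hC : 0 ≤ p * δ ^ (-p - 1) := mul_nonneg hp (Real.rpow_nonneg hδ.le _)
  have h := intervalIntegral.norm_integral_le_of_norm_le_const (a := (1:ℝ)) (b := z)
    (C := p * δ ^ (-p - 1) * |z - 1|) (f := fun s : ℝ => 1 - s ^ (-p)) (fun s hs => by
      have hs' : s ∈ uIcc 1 z := uIoc_subset_uIcc hs
      have h1 : δ ≤ s := (le_min hδ1 hz).trans hs'.1
      have h2 := abs_rpow_sub_one_le (q := -p) (by linarith) hδ hδ1 h1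
      rw [abs_neg, abs_of_nonneg hp] at h2
      rw [Real.norm_eq_abs, abs_sub_comm]
      refine h2.trans (mul_le_mul_of_nonneg_left ?_ hC)
      exact abs_sub_left_of_mem_uIcc hs')
  calc relEnt p z ≤ ‖relEnt p z‖ := Real.le_norm_self _
    _ ≤ _ := h
    _ = p * δ ^ (-p - 1) * (z - 1) ^ 2 := by rw [mul_assoc, abs_mul_abs_self, sq]

theorem sq_le_relEnt_one {z : ℝ} (hz : 0 < z) : (z - 1) ^ 2 ≤ 2 * (z + 1) * relEnt 1 z := by
  have hs := Real.sqrt_pos.2 hz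
  have hsq := Real.sq_sqrt hz.le
  have h1 : Real.log z ≤ 2 * (Real.sqrt z - 1) := by
    have := Real.log_le_sub_one_of_pos hs
    rw [Real.log_sqrt hz.le] at this
    linarith
  rw [relEnt_one hz]
  set s := Real.sqrt z
  have h2 : (s - 1) ^ 2 ≤ z - 1 - Real.log z := by nlinarith
  have h3 : (z - 1) ^ 2 = (s + 1) ^ 2 * (s - 1) ^ 2 := by rw [← hsq]; ring
  have h4 : (s + 1) ^ 2 ≤ 2 * (z + 1) := by nlinarith [sq_nonneg (s - 1)]
  rw [h3]
  exact mul_le_mul h4 h2 (sq_nonneg _) (by linarith)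

theorem le_relEnt_one {z : ℝ} (hz : 0 < z) : z ≤ 2 * relEnt 1 z + 2 := by
  have h := Real.log_le_sub_one_of_pos (half_pos hz)
  rw [Real.log_div hz.ne' two_ne_zero] at h
  have := Real.log_two_lt_d9
  rw [relEnt_one hz]
  linarith

/-- The remainder density `(z z⁻ᵖ - 1)² / z⁻ᵖ`. -/
def remDens (p z : ℝ) : ℝ := (z ^ (-p) * z - 1) ^ 2 / z ^ (-p)

theorem remDens_eq {p z : ℝ} (hz : 0 < z) : remDens p z = z ^ p * (z ^ (1 - p) - 1) ^ 2 := by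
  have h1 : z ^ (-p) * z = z ^ (1 - p) := by
    rw [sub_eq_neg_add, Real.rpow_add hz, Real.rpow_one]
  rw [remDens, h1, Real.rpow_neg hz.le, div_inv_eq_mul, mul_comm]

theorem remDens_one {z : ℝ} (hz : 0 < z) : remDens 1 z = 0 := by
  simp [remDens_eq hz]

theorem remDens_le_mid {p : ℝ} (hp : 0 ≤ p) :
    ∃ C, 0 ≤ C ∧ ∀ z, 1 / 2 ≤ z → z ≤ 2 → remDens p z ≤ C * relEnt 1 z := by
  set L := |1 - p| * (1 / 2 : ℝ) ^ (1 - p - 1)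
  refine ⟨2 ^ p * (L ^ 2 * 6), by positivity, fun z h1 h2 => ?_⟩
  have hz : 0 < z := by linarith
  have hG := relEnt_nonneg zero_le_one hz
  have hl := abs_rpow_sub_one_le (q := 1 - p) (by linarith) (by norm_num : (0:ℝ) < 1 / 2)
    (by norm_num) h1
  have hl2 : (z ^ (1 - p) - 1) ^ 2 ≤ L ^ 2 * (z - 1) ^ 2 := by
    rw [← sq_abs, ← sq_abs (z - 1), ← mul_pow]
    exact pow_le_pow_left₀ (abs_nonneg _) hl 2
  have hq := sq_le_relEnt_one hz
  have hq' : (z - 1) ^ 2 ≤ 6 * relEnt 1 z := by nlinarith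
  rw [remDens_eq hz, mul_assoc]
  refine mul_le_mul (Real.rpow_le_rpow hz.le h2 hp) ?_ (sq_nonneg _) (by positivity)
  rw [mul_assoc]
  exact hl2.trans (mul_le_mul_of_nonneg_left hq' (sq_nonneg _))

theorem relEnt_one_of_le_half {z : ℝ} (hz : 0 < z) (h : z ≤ 1 / 2) : 1 ≤ 12 * relEnt 1 z := by
  have := sq_le_relEnt_one hz
  have := relEnt_nonneg zero_le_one hz
  nlinarith

theorem relEnt_one_of_two_le {z : ℝ} (h : 2 ≤ z) : z ≤ 12 * relEnt 1 z := by
  have h1 := sq_le_relEnt_one (by linarith : 0 < z)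
  have h2 := relEnt_nonneg zero_le_one (by linarith : 0 < z)
  have h3 : z * z ≤ z * (12 * relEnt 1 z) := by nlinarith
  exact le_of_mul_le_mul_left h3 (by linarith)

theorem remDens_le_of_lt_one {p : ℝ} (hp : 0 ≤ p) (hp1 : p < 1) :
    ∃ C, 0 < C ∧ ∀ z, 0 < z → remDens p z ≤ C * ((1 + z ^ (1 - p)) * relEnt 1 z) := by
  obtain ⟨C, hC, hmid⟩ := remDens_le_mid hp
  refine ⟨C + 12, by linarith, fun z hz => ?_⟩
  have hG := relEnt_nonneg zero_le_one hz
  have hpow : 0 < z ^ (1 - p) := Real.rpow_pos_of_pos hz _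
  rcases le_total z (1 / 2) with h | h
  · have h1 := relEnt_one_of_le_half hz h
    have h2 : z ^ p ≤ 1 := Real.rpow_le_one hz.le (by linarith) hp
    have h3 : z ^ (1 - p) ≤ 1 := Real.rpow_le_one hz.le (by linarith) (by linarith)
    have h4 : (z ^ (1 - p) - 1) ^ 2 ≤ 1 := by nlinarith
    have h5 : remDens p z ≤ 1 := by
      rw [remDens_eq hz]
      exact mul_le_one₀ h2 (sq_nonneg _) h4
    nlinarith [mul_nonneg hpow.le hG, mul_nonneg hC hG,
      mul_nonneg hC (mul_nonneg hpow.le hG)]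
  rcases le_total z 2 with h' | h'
  · have := hmid z h h'
    nlinarith [mul_nonneg hpow.le hG, mul_nonneg hC (mul_nonneg hpow.le hG)]
  · have h1 := relEnt_one_of_two_le h'
    have h3 : 1 ≤ z ^ (1 - p) := Real.one_le_rpow (by linarith) (by linarith)
    have h4 : (z ^ (1 - p) - 1) ^ 2 ≤ z ^ (1 - p) * z ^ (1 - p) := by nlinarith
    have h5 : remDens p z ≤ z ^ (1 - p) * z := by
      rw [remDens_eq hz]
      refine (mul_le_mul_of_nonneg_left h4 (Real.rpow_nonneg hz.le _)).trans (le_of_eq ?_)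
      rw [← mul_assoc, ← Real.rpow_add hz]
      simp [mul_comm]
    have h6 := mul_le_mul_of_nonneg_left h1 hpow.le
    nlinarith [mul_nonneg hpow.le hG, mul_nonneg hC hG,
      mul_nonneg hC (mul_nonneg hpow.le hG)]

theorem remDens_le_of_one_lt {p : ℝ} (hp1 : 1 < p) :
    ∃ C, 0 < C ∧ ∀ z, 0 < z →
      remDens p z ≤ C * ((1 + z ^ (p - 1)) * relEnt 1 z) + C * relEnt p z := by
  have hp : 0 ≤ p := by linarith
  obtain ⟨C, hC, hmid⟩ := remDens_le_mid hp
  refine ⟨C + 12 * p, by positivity, fun z hz => ?_⟩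
  have hG := relEnt_nonneg zero_le_one hz
  have hGp := relEnt_nonneg hp hz
  have hpow : 0 < z ^ (p - 1) := Real.rpow_pos_of_pos hz _
  have k1 := mul_nonneg hpow.le hG
  have k2 := mul_nonneg hC hG
  have k3 := mul_nonneg hC (mul_nonneg hpow.le hG)
  have k4 := mul_nonneg hC hGp
  have k5 := mul_nonneg hp hG
  have k6 := mul_nonneg hp hGp
  have k7 := mul_nonneg hp k1
  rcases le_total z (1 / 2) with h | h
  · have h1 := relEnt_one_of_le_half hz h
    have h3 : 1 ≤ z ^ (1 - p) :=
      Real.one_le_rpow_of_pos_of_le_one_of_nonpos hz (by linarith) (by linarith)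
    have h4 : (z ^ (1 - p) - 1) ^ 2 ≤ z ^ (1 - p) * z ^ (1 - p) := by nlinarith
    have h5 : remDens p z ≤ z ^ (1 - p) := by
      rw [remDens_eq hz]
      refine (mul_le_mul_of_nonneg_left h4 (Real.rpow_nonneg hz.le _)).trans ?_
      rw [← mul_assoc, ← Real.rpow_add hz]
      have : z ^ (p + (1 - p)) = z := by simp
      rw [this]
      nlinarith
    have h6 := relEnt_of_ne_one hp1.ne' hz
    have h7 : z ^ (1 - p) = 1 + (p - 1) * (relEnt p z + 1 - z) := by
      rw [h6]
      field_simp [(by linarith : 1 - p ≠ 0)]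
      ring
    have h8 : z ^ (1 - p) ≤ p * relEnt p z + p := by rw [h7]; nlinarith
    nlinarith [mul_le_mul_of_nonneg_left h1 hp]
  rcases le_total z 2 with h' | h'
  · have := hmid z h h'
    nlinarith
  · have h1 := relEnt_one_of_two_le h'
    have h3 : z ^ (1 - p) ≤ 1 :=
      Real.rpow_le_one_of_one_le_of_nonpos (by linarith) (by linarith)
    have h3' : 0 < z ^ (1 - p) := Real.rpow_pos_of_pos hz _
    have h4 : (z ^ (1 - p) - 1) ^ 2 ≤ 1 := by nlinarith
    have h5 : remDens p z ≤ z ^ (p - 1) * z := by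
      rw [remDens_eq hz]
      have : z ^ (p - 1) * z = z ^ p := by
        rw [Real.rpow_sub_one hz.ne']; field_simp
      rw [this]
      exact mul_le_of_le_one_right (Real.rpow_nonneg hz.le _) h4
    have h6 := mul_le_mul_of_nonneg_left h1 hpow.le
    nlinarith

theorem rpow_le_add_of_lt {a c ε : ℝ} (ha : 0 ≤ a) (hac : a < c) (hε : 0 < ε) :
    ∃ M, 0 < M ∧ ∀ z : ℝ, 0 < z → z ^ a ≤ ε * z ^ c + M := by
  have hd : 0 < c - a := by linarith
  set z₀ : ℝ := (ε⁻¹) ^ (c - a)⁻¹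
  have hz₀ : 0 < z₀ := by positivity
  refine ⟨z₀ ^ a, by positivity, fun z hz => ?_⟩
  rcases le_total z z₀ with h | h
  · have := Real.rpow_le_rpow hz.le h ha
    have : 0 < ε * z ^ c := by positivity
    linarith
  · have h1 : ε⁻¹ ≤ z ^ (c - a) := by
      calc ε⁻¹ = z₀ ^ (c - a) := by
            rw [← Real.rpow_mul (by positivity), inv_mul_cancel₀ hd.ne', Real.rpow_one]
        _ ≤ _ := Real.rpow_le_rpow hz₀.le h hd.le
    have h2 : 1 ≤ ε * z ^ (c - a) := by
      calc (1:ℝ) = ε * ε⁻¹ := (mul_inv_cancel₀ hε.ne').symm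
        _ ≤ _ := mul_le_mul_of_nonneg_left h1 hε.le
    have h3 : z ^ c = z ^ a * z ^ (c - a) := by rw [← Real.rpow_add hz]; simp
    have h4 : 0 < z ^ a := by positivity
    have h5 : z ^ a * 1 ≤ z ^ a * (ε * z ^ (c - a)) := mul_le_mul_of_nonneg_left h2 h4.le
    have h6 : 0 < z₀ ^ a := by positivity
    rw [h3]
    nlinarith

theorem rpow_le_one_add {a c z : ℝ} (ha : 0 ≤ a) (hac : a ≤ c) (hz : 0 < z) :
    z ^ a ≤ 1 + z ^ c := by
  rcases le_total z 1 with h | h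
  · have := Real.rpow_le_one hz.le h ha
    have := Real.rpow_pos_of_pos hz c
    linarith
  · have := Real.rpow_le_rpow_of_exponent_le h hac
    linarith

/-! ### Calculus on intervals -/

theorem gronwall_integral {f : ℝ → ℝ} (hf : Continuous f) {A C T : ℝ} (hC : 0 ≤ C)
    (h : ∀ t ∈ Icc 0 T, f t ≤ A + C * ∫ s in (0:ℝ)..t, f s) {t : ℝ} (ht : t ∈ Icc 0 T) :
    f t ≤ A * Real.exp (C * t) := by
  set g : ℝ → ℝ := fun t => Real.exp (-(C * t)) * (A + C * ∫ s in (0:ℝ)..t, f s) with hg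
  have hgd : ∀ t, HasDerivAt g (-C * Real.exp (-(C * t)) * (A + C * ∫ s in (0:ℝ)..t, f s)
      + Real.exp (-(C * t)) * (C * f t)) t := fun t => by
    have h1 : HasDerivAt (fun t => Real.exp (-(C * t))) (-C * Real.exp (-(C * t))) t := by
      have h0 : HasDerivAt (fun t => -(C * t)) (-C) t := by
        simpa only [mul_one] using ((hasDerivAt_id' t).const_mul C).fun_neg
      simpa [mul_comm] using h0.exp
    have h2 : HasDerivAt (fun t => A + C * ∫ s in (0:ℝ)..t, f s) (C * f t) t :=
      ((hf.integral_hasStrictDerivAt 0 t).hasDerivAt.const_mul C).const_add A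
    exact h1.mul h2
  have hanti : AntitoneOn g (Icc 0 T) := by
    refine antitoneOn_of_deriv_nonpos (convex_Icc 0 T)
      (fun x _ => (hgd x).continuousAt.continuousWithinAt)
      (fun x _ => (hgd x).differentiableAt.differentiableWithinAt) fun x hx => ?_
    rw [interior_Icc] at hx
    rw [(hgd x).deriv]
    have h1 := h x ⟨hx.1.le, hx.2.le⟩
    have h2 : 0 ≤ C * Real.exp (-(C * x)) := by positivity
    nlinarith
  have h0 : g t ≤ A := by
    have := hanti ⟨le_refl 0, ht.1.trans ht.2⟩ ht ht.1
    simpa [hg] using this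
  have hexp : Real.exp (-(C * t)) * Real.exp (C * t) = 1 := by
    rw [← Real.exp_add]; simp
  have hpos := Real.exp_pos (C * t)
  have h1 := mul_le_mul_of_nonneg_right h0 hpos.le
  have h2 : g t * Real.exp (C * t) = A + C * ∫ s in (0:ℝ)..t, f s := by
    simp only [hg]
    linear_combination (A + C * ∫ s in (0:ℝ)..t, f s) * hexp
  linarith [h t ht]

theorem exists_le_integral_unit {h : ℝ → ℝ} (hh : Continuous h) (a : ℝ) :
    ∃ y ∈ Icc a (a + 1), h y ≤ ∫ s in a..(a + 1), h s := by
  by_contra! hcon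
  have hlt := intervalIntegral.integral_lt_integral_of_continuousOn_of_le_of_exists_lt
    (a := a) (b := a + 1) (f := fun _ => ∫ s in a..(a + 1), h s) (g := h) (by linarith)
    continuousOn_const hh.continuousOn
    (fun x hx => (hcon x ⟨hx.1.le, hx.2⟩).le)
    ⟨a, ⟨le_refl _, by linarith⟩, hcon a ⟨le_refl _, by linarith⟩⟩
  simp at hlt

theorem le_add_integral_abs_deriv {g g' : ℝ → ℝ} (hg : ∀ x, HasDerivAt g (g' x) x)
    (hg' : Continuous g') {a x y : ℝ} (hx : x ∈ Icc a (a + 1)) (hy : y ∈ Icc a (a + 1)) :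
    g x ≤ g y + ∫ s in a..(a + 1), |g' s| := by
  have h1 : ∫ s in y..x, g' s = g x - g y :=
    intervalIntegral.integral_eq_sub_of_hasDerivAt (fun z _ => hg z)
      (hg'.intervalIntegrable _ _)
  have h2 : |∫ s in y..x, g' s| ≤ |(∫ s in y..x, |g' s|)| :=
    intervalIntegral.norm_integral_le_abs_integral_norm (f := g')
  have h3 : |(∫ s in y..x, |g' s|)| ≤ |(∫ s in a..(a + 1), |g' s|)| := by
    refine intervalIntegral.abs_integral_mono_interval ?_ ?_ (hg'.abs.intervalIntegrable _ _)
    · rw [uIoc_of_le (by linarith : a ≤ a + 1)]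
      exact Ioc_subset_Ioc (le_min hy.1 hx.1) (max_le hy.2 hx.2)
    · exact Eventually.of_forall fun s => abs_nonneg _
  have h4 : 0 ≤ ∫ s in a..(a + 1), |g' s| :=
    intervalIntegral.integral_nonneg (by linarith) fun _ _ => abs_nonneg _
  rw [abs_of_nonneg h4] at h3
  have := le_abs_self (∫ s in y..x, g' s)
  linarith

theorem integral_mono_cont {f g : ℝ → ℝ} (hf : Continuous f) (hg : Continuous g) {a b : ℝ}
    (hab : a ≤ b) (h : ∀ x ∈ Icc a b, f x ≤ g x) :
    ∫ x in a..b, f x ≤ ∫ x in a..b, g x :=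
  intervalIntegral.integral_mono_on hab (hf.intervalIntegrable _ _) (hg.intervalIntegrable _ _) h

theorem integral_mono_interval_cont {f : ℝ → ℝ} (hf : Continuous f) (h0 : ∀ x, 0 ≤ f x)
    {a b c d : ℝ} (hca : c ≤ a) (hab : a ≤ b) (hbd : b ≤ d) :
    ∫ x in a..b, f x ≤ ∫ x in c..d, f x :=
  intervalIntegral.integral_mono_interval hca hab hbd (Eventually.of_forall h0)
    (hf.intervalIntegrable _ _)

theorem integral_swap_cont {f : ℝ → ℝ → ℝ} (hf : Continuous fun p : ℝ × ℝ => f p.1 p.2)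
    (a b c d : ℝ) :
    ∫ t in c..d, ∫ x in a..b, f x t = ∫ x in a..b, ∫ t in c..d, f x t := by
  have hc : Continuous (Function.uncurry fun t x => f x t) :=
    hf.comp (continuous_snd.prodMk continuous_fst)
  refine intervalIntegral_intervalIntegral_swap ?_
  exact (hc.continuousOn.integrableOn_compact
    (isCompact_uIcc.prod isCompact_uIcc)).mono_set
    (prod_mono uIoc_subset_uIcc uIoc_subset_uIcc)

/-- Averages of a continuous function vanishing at infinity tend to zero. -/
theorem exists_integral_le_mul {f : ℝ → ℝ → ℝ} (hf : Continuous fun p : ℝ × ℝ => f p.1 p.2)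
    (hlim : Tendsto (fun p : ℝ × ℝ => f p.1 p.2) (cocompact ℝ ×ˢ ⊤) (nhds 0)) (T : ℝ) {κ : ℝ}
    (hκ : 0 < κ) :
    ∃ R₀, ∀ R ≥ R₀, ∀ t ∈ Icc 0 T, ∫ x in (-R)..R, f x t ≤ κ * R := by
  have hev : ∀ᶠ p : ℝ × ℝ in cocompact ℝ ×ˢ ⊤, f p.1 p.2 < κ / 4 :=
    hlim.eventually_lt_const (by linarith)
  obtain ⟨q, hq, r, hr, hqr⟩ := eventually_prod_iff.1 hev
  rw [eventually_top] at hr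
  obtain ⟨s, hs, hsq⟩ := mem_cocompact.1 hq
  obtain ⟨M₀, hM₀⟩ := hs.isBounded.subset_closedBall (0:ℝ)
  set M := max M₀ 0
  have hM : 0 ≤ M := le_max_right _ _
  have hout : ∀ x t, M < |x| → f x t ≤ κ / 4 := fun x t hx => by
    refine (hqr (hsq fun hxs => ?_) (hr t)).le
    have := hM₀ hxs
    rw [mem_closedBall_zero_iff, Real.norm_eq_abs] at this
    exact absurd (this.trans (le_max_left M₀ 0)) (not_le.2 hx)
  obtain ⟨B₀, hB₀⟩ := ((isCompact_Icc (a := -M) (b := M)).prod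
    (isCompact_Icc (a := (0:ℝ)) (b := T))).exists_bound_of_continuousOn hf.continuousOn
  set B := max B₀ 0
  have hB : 0 ≤ B := le_max_right _ _
  refine ⟨max M (4 * M * B / κ), fun R hR t ht => ?_⟩
  have hRM : M ≤ R := (le_max_left _ _).trans hR
  have hRB : 4 * M * B ≤ κ * R := by
    have := (le_max_right _ _).trans hR
    rw [div_le_iff₀ hκ] at this
    linarith
  have hft : Continuous fun x => f x t := hf.comp (continuous_id.prodMk continuous_const)
  have hii : ∀ a b, IntervalIntegrable (fun x => f x t) volume a b :=
    fun a b => hft.intervalIntegrable a b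
  have h1 : ∫ x in (-R)..(-M), f x t ≤ κ / 4 * (R - M) := by
    have h := intervalIntegral.integral_mono_on_of_le_Ioo (by linarith : -R ≤ -M)
      (hii _ _) (intervalIntegrable_const (c := κ / 4)) fun x hx =>
        hout x t (by rw [lt_abs]; right; linarith [hx.2])
    rw [intervalIntegral.integral_const, smul_eq_mul] at h
    linarith
  have h2 : ∫ x in M..R, f x t ≤ κ / 4 * (R - M) := by
    have h := intervalIntegral.integral_mono_on_of_le_Ioo hRM
      (hii _ _) (intervalIntegrable_const (c := κ / 4)) fun x hx =>
        hout x t (by rw [lt_abs]; left; linarith [hx.1])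
    rw [intervalIntegral.integral_const, smul_eq_mul] at h
    linarith
  have h3 : ∫ x in (-M)..M, f x t ≤ 2 * M * B := by
    have h := integral_mono_cont hft (continuous_const (y := B)) (by linarith : -M ≤ M)
      fun x hx => (le_abs_self _).trans ((hB₀ (x, t) ⟨hx, ht⟩).trans (le_max_left _ _))
    rw [intervalIntegral.integral_const, smul_eq_mul] at h
    linarith
  have h4 : ∫ x in (-R)..R, f x t = (∫ x in (-R)..(-M), f x t) + (∫ x in (-M)..M, f x t)
      + ∫ x in M..R, f x t := by
    rw [intervalIntegral.integral_add_adjacent_intervals (hii _ _) (hii _ _),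
      intervalIntegral.integral_add_adjacent_intervals (hii _ _) (hii _ _)]
  have h5 := mul_nonneg hκ.le hM
  rw [h4]
  linarith

/-! ### Flows -/

/-- A classical solution written in scalar components, with all functions continuously extended
to `ℝ × ℝ`. -/
structure MHDFlow (α β T K δ : ℝ) where
  v : ℝ → ℝ → ℝ
  u : ℝ → ℝ → ℝ
  θ : ℝ → ℝ → ℝ
  w₁ : ℝ → ℝ → ℝ
  w₂ : ℝ → ℝ → ℝ
  b₁ : ℝ → ℝ → ℝ
  b₂ : ℝ → ℝ → ℝ
  vx : ℝ → ℝ → ℝ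
  ux : ℝ → ℝ → ℝ
  θx : ℝ → ℝ → ℝ
  w₁x : ℝ → ℝ → ℝ
  w₂x : ℝ → ℝ → ℝ
  b₁x : ℝ → ℝ → ℝ
  b₂x : ℝ → ℝ → ℝ
  ut : ℝ → ℝ → ℝ
  θt : ℝ → ℝ → ℝ
  w₁t : ℝ → ℝ → ℝ
  w₂t : ℝ → ℝ → ℝ
  b₁t : ℝ → ℝ → ℝ
  b₂t : ℝ → ℝ → ℝ
  continuous_v : Continuous fun p : ℝ × ℝ => v p.1 p.2
  continuous_u : Continuous fun p : ℝ × ℝ => u p.1 p.2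
  continuous_θ : Continuous fun p : ℝ × ℝ => θ p.1 p.2
  continuous_w₁ : Continuous fun p : ℝ × ℝ => w₁ p.1 p.2
  continuous_w₂ : Continuous fun p : ℝ × ℝ => w₂ p.1 p.2
  continuous_b₁ : Continuous fun p : ℝ × ℝ => b₁ p.1 p.2
  continuous_b₂ : Continuous fun p : ℝ × ℝ => b₂ p.1 p.2
  continuous_vx : Continuous fun p : ℝ × ℝ => vx p.1 p.2
  continuous_ux : Continuous fun p : ℝ × ℝ => ux p.1 p.2
  continuous_θx : Continuous fun p : ℝ × ℝ => θx p.1 p.2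
  continuous_w₁x : Continuous fun p : ℝ × ℝ => w₁x p.1 p.2
  continuous_w₂x : Continuous fun p : ℝ × ℝ => w₂x p.1 p.2
  continuous_b₁x : Continuous fun p : ℝ × ℝ => b₁x p.1 p.2
  continuous_b₂x : Continuous fun p : ℝ × ℝ => b₂x p.1 p.2
  continuous_ut : Continuous fun p : ℝ × ℝ => ut p.1 p.2
  continuous_θt : Continuous fun p : ℝ × ℝ => θt p.1 p.2
  continuous_w₁t : Continuous fun p : ℝ × ℝ => w₁t p.1 p.2
  continuous_w₂t : Continuous fun p : ℝ × ℝ => w₂t p.1 p.2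
  continuous_b₁t : Continuous fun p : ℝ × ℝ => b₁t p.1 p.2
  continuous_b₂t : Continuous fun p : ℝ × ℝ => b₂t p.1 p.2
  v_pos : ∀ x t, 0 < v x t
  θ_pos : ∀ x t, 0 < θ x t
  dx_v : ∀ x t, HasDerivAt (fun y => v y t) (vx x t) x
  dx_u : ∀ x t, HasDerivAt (fun y => u y t) (ux x t) x
  dx_θ : ∀ x t, HasDerivAt (fun y => θ y t) (θx x t) x
  dx_w₁ : ∀ x t, HasDerivAt (fun y => w₁ y t) (w₁x x t) x
  dx_w₂ : ∀ x t, HasDerivAt (fun y => w₂ y t) (w₂x x t) x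
  dx_b₁ : ∀ x t, HasDerivAt (fun y => b₁ y t) (b₁x x t) x
  dx_b₂ : ∀ x t, HasDerivAt (fun y => b₂ y t) (b₂x x t) x
  dt_v : ∀ x, ∀ t ∈ Ioo 0 T, HasDerivAt (fun s => v x s) (ux x t) t
  dt_u : ∀ x, ∀ t ∈ Ioo 0 T, HasDerivAt (fun s => u x s) (ut x t) t
  dt_θ : ∀ x, ∀ t ∈ Ioo 0 T, HasDerivAt (fun s => θ x s) (θt x t) t
  dt_w₁ : ∀ x, ∀ t ∈ Ioo 0 T, HasDerivAt (fun s => w₁ x s) (w₁t x t) t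
  dt_w₂ : ∀ x, ∀ t ∈ Ioo 0 T, HasDerivAt (fun s => w₂ x s) (w₂t x t) t
  dt_b₁ : ∀ x, ∀ t ∈ Ioo 0 T, HasDerivAt (fun s => b₁ x s) (b₁t x t) t
  dt_b₂ : ∀ x, ∀ t ∈ Ioo 0 T, HasDerivAt (fun s => b₂ x s) (b₂t x t) t
  far_v : Tendsto (fun p : ℝ × ℝ => v p.1 p.2) (cocompact ℝ ×ˢ ⊤) (nhds 1)
  far_u : Tendsto (fun p : ℝ × ℝ => u p.1 p.2) (cocompact ℝ ×ˢ ⊤) (nhds 0)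
  far_θ : Tendsto (fun p : ℝ × ℝ => θ p.1 p.2) (cocompact ℝ ×ˢ ⊤) (nhds 1)
  far_w₁ : Tendsto (fun p : ℝ × ℝ => w₁ p.1 p.2) (cocompact ℝ ×ˢ ⊤) (nhds 0)
  far_w₂ : Tendsto (fun p : ℝ × ℝ => w₂ p.1 p.2) (cocompact ℝ ×ˢ ⊤) (nhds 0)
  far_b₁ : Tendsto (fun p : ℝ × ℝ => b₁ p.1 p.2) (cocompact ℝ ×ˢ ⊤) (nhds 0)
  far_b₂ : Tendsto (fun p : ℝ × ℝ => b₂ p.1 p.2) (cocompact ℝ ×ˢ ⊤) (nhds 0)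
  momentum : ∀ x t, HasDerivAt (fun y => visc α (v y t) * ux y t / v y t
    - (θ y t / v y t + (b₁ y t ^ 2 + b₂ y t ^ 2) / 2)) (ut x t) x
  transverse₁ : ∀ x t, HasDerivAt (fun y => w₁x y t / v y t + b₁ y t) (w₁t x t) x
  transverse₂ : ∀ x t, HasDerivAt (fun y => w₂x y t / v y t + b₂ y t) (w₂t x t) x
  magnetic₁ : ∀ x t, HasDerivAt (fun y => b₁x y t / v y t + w₁ y t)
    (ux x t * b₁ x t + v x t * b₁t x t) x
  magnetic₂ : ∀ x t, HasDerivAt (fun y => b₂x y t / v y t + w₂ y t)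
    (ux x t * b₂ x t + v x t * b₂t x t) x
  temperature : ∀ x t, HasDerivAt (fun y => θ y t ^ β * θx y t / v y t)
    (θt x t + θ x t / v x t * ux x t
      - (visc α (v x t) * ux x t ^ 2 + (w₁x x t ^ 2 + w₂x x t ^ 2)
        + (b₁x x t ^ 2 + b₂x x t ^ 2)) / v x t) x
  initial : ∀ R, 0 ≤ R → ∫ x in (-R)..R, ((v x 0 - 1) ^ 2 + u x 0 ^ 2 + (θ x 0 - 1) ^ 2
    + (b₁ x 0 ^ 2 + b₂ x 0 ^ 2) + (w₁ x 0 ^ 2 + w₂ x 0 ^ 2) + vx x 0 ^ 2) ≤ K ^ 2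
  v_initial : ∀ x, δ ≤ v x 0
  θ_initial : ∀ x, δ ≤ θ x 0

namespace MHDFlow

variable {α β T K δ : ℝ} (S : MHDFlow α β T K δ) {X : Type*} [TopologicalSpace X] {f g : X → ℝ}

@[simp] theorem v_ne (x t : ℝ) : S.v x t ≠ 0 := (S.v_pos x t).ne'

@[simp] theorem θ_ne (x t : ℝ) : S.θ x t ≠ 0 := (S.θ_pos x t).ne'

@[fun_prop] theorem cont_v (hf : Continuous f) (hg : Continuous g) :
    Continuous fun a => S.v (f a) (g a) := S.continuous_v.comp (hf.prodMk hg)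

@[fun_prop] theorem cont_u (hf : Continuous f) (hg : Continuous g) :
    Continuous fun a => S.u (f a) (g a) := S.continuous_u.comp (hf.prodMk hg)

@[fun_prop] theorem cont_θ (hf : Continuous f) (hg : Continuous g) :
    Continuous fun a => S.θ (f a) (g a) := S.continuous_θ.comp (hf.prodMk hg)

@[fun_prop] theorem cont_w₁ (hf : Continuous f) (hg : Continuous g) :
    Continuous fun a => S.w₁ (f a) (g a) := S.continuous_w₁.comp (hf.prodMk hg)

@[fun_prop] theorem cont_w₂ (hf : Continuous f) (hg : Continuous g) :
    Continuous fun a => S.w₂ (f a) (g a) := S.continuous_w₂.comp (hf.prodMk hg)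

@[fun_prop] theorem cont_b₁ (hf : Continuous f) (hg : Continuous g) :
    Continuous fun a => S.b₁ (f a) (g a) := S.continuous_b₁.comp (hf.prodMk hg)

@[fun_prop] theorem cont_b₂ (hf : Continuous f) (hg : Continuous g) :
    Continuous fun a => S.b₂ (f a) (g a) := S.continuous_b₂.comp (hf.prodMk hg)

@[fun_prop] theorem cont_vx (hf : Continuous f) (hg : Continuous g) :
    Continuous fun a => S.vx (f a) (g a) := S.continuous_vx.comp (hf.prodMk hg)

@[fun_prop] theorem cont_ux (hf : Continuous f) (hg : Continuous g) :
    Continuous fun a => S.ux (f a) (g a) := S.continuous_ux.comp (hf.prodMk hg)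

@[fun_prop] theorem cont_θx (hf : Continuous f) (hg : Continuous g) :
    Continuous fun a => S.θx (f a) (g a) := S.continuous_θx.comp (hf.prodMk hg)

@[fun_prop] theorem cont_w₁x (hf : Continuous f) (hg : Continuous g) :
    Continuous fun a => S.w₁x (f a) (g a) := S.continuous_w₁x.comp (hf.prodMk hg)

@[fun_prop] theorem cont_w₂x (hf : Continuous f) (hg : Continuous g) :
    Continuous fun a => S.w₂x (f a) (g a) := S.continuous_w₂x.comp (hf.prodMk hg)

@[fun_prop] theorem cont_b₁x (hf : Continuous f) (hg : Continuous g) :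
    Continuous fun a => S.b₁x (f a) (g a) := S.continuous_b₁x.comp (hf.prodMk hg)

@[fun_prop] theorem cont_b₂x (hf : Continuous f) (hg : Continuous g) :
    Continuous fun a => S.b₂x (f a) (g a) := S.continuous_b₂x.comp (hf.prodMk hg)

@[fun_prop] theorem cont_ut (hf : Continuous f) (hg : Continuous g) :
    Continuous fun a => S.ut (f a) (g a) := S.continuous_ut.comp (hf.prodMk hg)

@[fun_prop] theorem cont_θt (hf : Continuous f) (hg : Continuous g) :
    Continuous fun a => S.θt (f a) (g a) := S.continuous_θt.comp (hf.prodMk hg)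

@[fun_prop] theorem cont_w₁t (hf : Continuous f) (hg : Continuous g) :
    Continuous fun a => S.w₁t (f a) (g a) := S.continuous_w₁t.comp (hf.prodMk hg)

@[fun_prop] theorem cont_w₂t (hf : Continuous f) (hg : Continuous g) :
    Continuous fun a => S.w₂t (f a) (g a) := S.continuous_w₂t.comp (hf.prodMk hg)

@[fun_prop] theorem cont_b₁t (hf : Continuous f) (hg : Continuous g) :
    Continuous fun a => S.b₁t (f a) (g a) := S.continuous_b₁t.comp (hf.prodMk hg)

@[fun_prop] theorem cont_b₂t (hf : Continuous f) (hg : Continuous g) :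
    Continuous fun a => S.b₂t (f a) (g a) := S.continuous_b₂t.comp (hf.prodMk hg)

@[fun_prop] theorem cont_v_rpow (p : ℝ) (hf : Continuous f) (hg : Continuous g) :
    Continuous fun a => S.v (f a) (g a) ^ p :=
  (S.cont_v hf hg).rpow_const fun _ => Or.inl (by simp)

@[fun_prop] theorem cont_relEnt_v (p : ℝ) (hf : Continuous f) (hg : Continuous g) :
    Continuous fun a => relEnt p (S.v (f a) (g a)) :=
  (continuousOn_relEnt p).comp_continuous (S.cont_v hf hg) fun _ => S.v_pos _ _

@[fun_prop] theorem cont_θ_rpow (p : ℝ) (hf : Continuous f) (hg : Continuous g) :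
    Continuous fun a => S.θ (f a) (g a) ^ p :=
  (S.cont_θ hf hg).rpow_const fun _ => Or.inl (by simp)

@[fun_prop] theorem cont_relEnt_θ (p : ℝ) (hf : Continuous f) (hg : Continuous g) :
    Continuous fun a => relEnt p (S.θ (f a) (g a)) :=
  (continuousOn_relEnt p).comp_continuous (S.cont_θ hf hg) fun _ => S.θ_pos _ _

@[fun_prop] theorem cont_visc (hf : Continuous f) (hg : Continuous g) :
    Continuous fun a => visc α (S.v (f a) (g a)) := by
  unfold visc
  fun_prop

theorem one_le_visc (hα : 0 ≤ α) (x t : ℝ) : 1 ≤ visc α (S.v x t) := by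
  have := mul_nonneg hα (Real.rpow_nonneg (S.v_pos x t).le (-α))
  simp only [visc]
  linarith

/-- Viscous and magnetic heating. -/
def heat (x t : ℝ) : ℝ := (visc α (S.v x t) * S.ux x t ^ 2 + (S.w₁x x t ^ 2 + S.w₂x x t ^ 2)
        + (S.b₁x x t ^ 2 + S.b₂x x t ^ 2)) / S.v x t

/-- Dissipation density associated with the entropy exponent `p`. -/
def diss (p x t : ℝ) : ℝ := S.θ x t ^ (-p) * S.heat x t
  + p * S.θ x t ^ (β - p - 1) * S.θx x t ^ 2 / S.v x t

/-- Energy density associated with the entropy exponent `p`. -/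
def energy (p x t : ℝ) : ℝ := S.u x t ^ 2 / 2 + (S.w₁ x t ^ 2 + S.w₂ x t ^ 2) / 2
  + S.v x t * (S.b₁ x t ^ 2 + S.b₂ x t ^ 2) / 2 + relEnt 1 (S.v x t) + relEnt p (S.θ x t)

/-- Time derivative of the energy density. -/
def energyRate (p x t : ℝ) : ℝ := S.u x t * S.ut x t
  + (S.w₁ x t * S.w₁t x t + S.w₂ x t * S.w₂t x t)
  + (S.ux x t * (S.b₁ x t ^ 2 + S.b₂ x t ^ 2) / 2
    + S.v x t * (S.b₁ x t * S.b₁t x t + S.b₂ x t * S.b₂t x t))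
  + (1 - (S.v x t)⁻¹) * S.ux x t + (1 - S.θ x t ^ (-p)) * S.θt x t

/-- Energy flux. -/
def flux (p x t : ℝ) : ℝ :=
  S.u x t * (visc α (S.v x t) * S.ux x t / S.v x t
    - (S.θ x t / S.v x t + (S.b₁ x t ^ 2 + S.b₂ x t ^ 2) / 2) + 1)
  + (S.w₁ x t * (S.w₁x x t / S.v x t + S.b₁ x t) + S.w₂ x t * (S.w₂x x t / S.v x t + S.b₂ x t))
  + (S.b₁ x t * (S.b₁x x t / S.v x t + S.w₁ x t) + S.b₂ x t * (S.b₂x x t / S.v x t + S.w₂ x t))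
  - (S.w₁ x t * S.b₁ x t + S.w₂ x t * S.b₂ x t)
  + (1 - S.θ x t ^ (-p)) * (S.θ x t ^ β * S.θx x t / S.v x t)

/-- Source term in the energy balance. -/
def source (p x t : ℝ) : ℝ := (S.θ x t ^ (-p) * S.θ x t - 1) * S.ux x t / S.v x t

/-- Remainder density controlling the source term. -/
def rem (p x t : ℝ) : ℝ := remDens p (S.θ x t) / S.v x t

/-- Weight of the cutoff error. -/
def cutErr (p x t : ℝ) : ℝ :=
  (S.u x t ^ 2 * (visc α (S.v x t) / S.v x t) * S.θ x t ^ p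
    + (S.w₁ x t ^ 2 + S.w₂ x t ^ 2 + (S.b₁ x t ^ 2 + S.b₂ x t ^ 2)) * (S.v x t)⁻¹ * S.θ x t ^ p
    + (1 - S.θ x t ^ (-p)) ^ 2 * (S.θ x t ^ β / S.v x t) * (S.θ x t ^ (p + 1) * p⁻¹)) / 2
  + |S.u x t * (1 - S.θ x t / S.v x t - (S.b₁ x t ^ 2 + S.b₂ x t ^ 2) / 2)|
  + |S.w₁ x t * S.b₁ x t + S.w₂ x t * S.b₂ x t|

@[fun_prop] theorem cont_heat (hf : Continuous f) (hg : Continuous g) :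
    Continuous fun a => S.heat (f a) (g a) := by
  unfold heat
  fun_prop (disch := intros; simp)

@[fun_prop] theorem cont_diss (p : ℝ) (hf : Continuous f) (hg : Continuous g) :
    Continuous fun a => S.diss p (f a) (g a) := by
  unfold diss
  fun_prop (disch := intros; simp)

@[fun_prop] theorem cont_energy (p : ℝ) (hf : Continuous f) (hg : Continuous g) :
    Continuous fun a => S.energy p (f a) (g a) := by
  unfold energy
  fun_prop (disch := intros; simp)

@[fun_prop] theorem cont_energyRate (p : ℝ) (hf : Continuous f) (hg : Continuous g) :
    Continuous fun a => S.energyRate p (f a) (g a) := by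
  unfold energyRate
  fun_prop (disch := intros; simp)

@[fun_prop] theorem cont_flux (p : ℝ) (hf : Continuous f) (hg : Continuous g) :
    Continuous fun a => S.flux p (f a) (g a) := by
  unfold flux
  fun_prop (disch := intros; simp)

@[fun_prop] theorem cont_source (p : ℝ) (hf : Continuous f) (hg : Continuous g) :
    Continuous fun a => S.source p (f a) (g a) := by
  unfold source
  fun_prop (disch := intros; simp)

@[fun_prop] theorem cont_rem (p : ℝ) (hf : Continuous f) (hg : Continuous g) :
    Continuous fun a => S.rem p (f a) (g a) := by
  unfold rem remDens
  fun_prop (disch := simp [(Real.rpow_pos_of_pos (S.θ_pos _ _) _).ne'])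

@[fun_prop] theorem cont_cutErr (p : ℝ) (hf : Continuous f) (hg : Continuous g) :
    Continuous fun a => S.cutErr p (f a) (g a) := by
  unfold cutErr
  fun_prop (disch := intros; simp)

theorem heat_nonneg (hα : 0 ≤ α) (x t : ℝ) : 0 ≤ S.heat x t := by
  have := S.one_le_visc hα x t
  have := S.v_pos x t
  unfold heat
  positivity

theorem heat_le_diss {p : ℝ} (hp : 0 ≤ p) (x t : ℝ) :
    S.θ x t ^ (-p) * S.heat x t ≤ S.diss p x t := by
  have := S.v_pos x t
  have := S.θ_pos x t
  unfold diss
  have : 0 ≤ p * S.θ x t ^ (β - p - 1) * S.θx x t ^ 2 / S.v x t := by positivity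
  linarith

theorem diss_nonneg (hα : 0 ≤ α) {p : ℝ} (hp : 0 ≤ p) (x t : ℝ) : 0 ≤ S.diss p x t :=
  (mul_nonneg (Real.rpow_nonneg (S.θ_pos x t).le _) (S.heat_nonneg hα x t)).trans
    (S.heat_le_diss hp x t)

theorem energy_nonneg {p : ℝ} (hp : 0 ≤ p) (x t : ℝ) : 0 ≤ S.energy p x t := by
  have := S.v_pos x t
  have := relEnt_nonneg zero_le_one (S.v_pos x t)
  have := relEnt_nonneg hp (S.θ_pos x t)
  unfold energy
  positivity

theorem rem_one (x t : ℝ) : S.rem 1 x t = 0 := by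
  simp [rem, remDens_one (S.θ_pos x t)]

theorem hasDerivAt_energy (p : ℝ) (x : ℝ) {t : ℝ} (ht : t ∈ Ioo 0 T) :
    HasDerivAt (fun s => S.energy p x s) (S.energyRate p x t) t := by
  have hv := S.dt_v x t ht
  have hθ := S.dt_θ x t ht
  have h1 := (((S.dt_u x t ht).fun_pow 2).div_const 2).fun_add
    ((((S.dt_w₁ x t ht).fun_pow 2).fun_add ((S.dt_w₂ x t ht).fun_pow 2)).div_const 2)
  have h2 := (hv.fun_mul (((S.dt_b₁ x t ht).fun_pow 2).fun_add
    ((S.dt_b₂ x t ht).fun_pow 2))).div_const 2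
  have h3 := (hasDerivAt_relEnt 1 (S.v_pos x t)).comp t hv
  have h4 := (hasDerivAt_relEnt p (S.θ_pos x t)).comp t hθ
  refine (((h1.fun_add h2).fun_add h3).fun_add h4).congr_deriv ?_
  simp only [energyRate, Real.rpow_neg_one]
  norm_num
  ring

theorem hasDerivAt_flux (p x t : ℝ) :
    HasDerivAt (fun y => S.flux p y t)
      (S.energyRate p x t + S.diss p x t - S.source p x t) x := by
  have hθ := S.dx_θ x t
  have h1 := (S.dx_u x t).fun_mul ((S.momentum x t).add_const 1)
  have h2 := ((S.dx_w₁ x t).fun_mul (S.transverse₁ x t)).fun_add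
    ((S.dx_w₂ x t).fun_mul (S.transverse₂ x t))
  have h3 := ((S.dx_b₁ x t).fun_mul (S.magnetic₁ x t)).fun_add
    ((S.dx_b₂ x t).fun_mul (S.magnetic₂ x t))
  have h4 := ((S.dx_w₁ x t).fun_mul (S.dx_b₁ x t)).fun_add
    ((S.dx_w₂ x t).fun_mul (S.dx_b₂ x t))
  have h5 := ((hθ.rpow_const (p := -p) (Or.inl (S.θ_ne x t))).const_sub 1).fun_mul
    (S.temperature x t)
  have h6 : S.θ x t ^ (β - p - 1) = S.θ x t ^ (-p - 1) * S.θ x t ^ β := by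
    rw [← Real.rpow_add (S.θ_pos x t)]; ring_nf
  refine ((((h1.fun_add h2).fun_add h3).fun_sub h4).fun_add h5).congr_deriv ?_
  simp only [energyRate, diss, source, heat, h6]
  field_simp [S.v_ne x t]
  ring


end MHDFlow

/-- Spatial cutoff supported in `[-R, R]`. -/
def cutoff (R x : ℝ) : ℝ := (1 - x ^ 2 / R ^ 2) ^ 2

@[fun_prop] theorem continuous_cutoff (R : ℝ) : Continuous (cutoff R) := by
  unfold cutoff
  fun_prop

theorem cutoff_nonneg (R x : ℝ) : 0 ≤ cutoff R x := sq_nonneg _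

theorem sq_div_sq_le_one {R x : ℝ} (hx : x ∈ Icc (-R) R) : x ^ 2 / R ^ 2 ≤ 1 :=
  div_le_one_of_le₀ (sq_le_sq' hx.1 hx.2) (sq_nonneg R)

theorem cutoff_le_one {R x : ℝ} (hx : x ∈ Icc (-R) R) : cutoff R x ≤ 1 := by
  have h1 := sq_div_sq_le_one hx
  have h2 : 0 ≤ x ^ 2 / R ^ 2 := by positivity
  unfold cutoff
  nlinarith

theorem half_le_cutoff {R N x : ℝ} (hR : 0 < R) (hRN : 2 * N ≤ R) (hx : x ∈ Icc (-N) N) :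
    1 / 2 ≤ cutoff R x := by
  have h2 : x ^ 2 ≤ N ^ 2 := sq_le_sq' hx.1 hx.2
  have hN : 0 ≤ N := by linarith [hx.1, hx.2]
  have h1 : x ^ 2 / R ^ 2 ≤ 1 / 4 := by
    rw [div_le_iff₀ (by positivity)]
    nlinarith
  unfold cutoff
  nlinarith

theorem hasDerivAt_cutoff (R x : ℝ) :
    HasDerivAt (cutoff R) ((1 - x ^ 2 / R ^ 2) * (-4 * x / R ^ 2)) x := by
  refine ((((hasDerivAt_id' x).fun_pow 2).div_const (R ^ 2)).const_sub 1 |>.fun_pow 2).congr_deriv ?_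
  norm_num
  ring

theorem cutoff_self {R : ℝ} (hR : R ≠ 0) : cutoff R R = 0 ∧ cutoff R (-R) = 0 := by
  simp [cutoff, hR]

theorem neg_mul_le_weighted_sq {k j m φ ψ X y : ℝ} (hkj : k * j = 1) (hj : 0 ≤ j) (hm : 0 ≤ m) :
    -(φ * ψ * (y * (m * X))) ≤ φ ^ 2 * (k * m * X ^ 2) / 2 + ψ ^ 2 * (y ^ 2 * m * j) / 2 := by
  have h : 0 ≤ (φ * k * X + ψ * y) ^ 2 * (j * m) := by positivity
  have e : (φ * k * X + ψ * y) ^ 2 * (j * m)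
      = (k * j) * φ ^ 2 * (k * m * X ^ 2) + 2 * (k * j) * (φ * ψ * (y * (m * X)))
        + ψ ^ 2 * (y ^ 2 * m * j) := by ring
  rw [hkj] at e
  linarith

namespace MHDFlow

variable {α β T K δ : ℝ} (S : MHDFlow α β T K δ)

set_option maxHeartbeats 400000 in
theorem neg_cutoff_deriv_mul_flux_le (hα : 0 ≤ α) {p : ℝ} (hp : 0 ≤ p) {R : ℝ} (hR : 4 ≤ R)
    {x : ℝ} (hx : x ∈ Icc (-R) R) (t : ℝ) :
    -((1 - x ^ 2 / R ^ 2) * (-4 * x / R ^ 2) * S.flux p x t)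
      ≤ cutoff R x * S.diss p x t / 2 + 4 / R * S.cutErr p x t := by
  have hv := S.v_pos x t
  have hθ := S.θ_pos x t
  have hμ := S.one_le_visc hα x t
  have hR0 : 0 < R := by linarith
  obtain ⟨φ, hφ⟩ : ∃ φ, φ = 1 - x ^ 2 / R ^ 2 := ⟨_, rfl⟩
  obtain ⟨ψ, hψ⟩ : ∃ ψ, ψ = -4 * x / R ^ 2 := ⟨_, rfl⟩
  have hφ0 : 0 ≤ φ := by rw [hφ]; linarith [sq_div_sq_le_one hx]
  have hφ1 : φ ≤ 1 := by rw [hφ]; linarith [show 0 ≤ x ^ 2 / R ^ 2 by positivity]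
  have hψa : |ψ| ≤ 4 / R := by
    rw [hψ, abs_div, abs_mul, abs_of_pos (show 0 < R ^ 2 by positivity), div_le_div_iff₀
      (by positivity) hR0]
    norm_num
    have := abs_le.2 hx
    nlinarith
  have hR4 : 4 / R ≤ 1 := by rw [div_le_one hR0]; exact hR
  have hψ2 : ψ ^ 2 ≤ 4 / R := by
    rw [← sq_abs, pow_two]
    exact (mul_le_of_le_one_left (abs_nonneg ψ) (hψa.trans hR4)).trans hψa
  have hcut : cutoff R x = φ ^ 2 := by rw [hφ]; rfl
  obtain ⟨k, hk⟩ : ∃ k, k = S.θ x t ^ (-p) := ⟨_, rfl⟩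
  obtain ⟨j, hj⟩ : ∃ j, j = S.θ x t ^ p := ⟨_, rfl⟩
  have hj0 : 0 ≤ j := by rw [hj]; positivity
  have hkj : k * j = 1 := by
    rw [hk, hj, ← Real.rpow_add hθ]; simp
  have hv' : 0 ≤ (S.v x t)⁻¹ := by positivity
  have hμv : 0 ≤ visc α (S.v x t) / S.v x t := by positivity
  have hu := neg_mul_le_weighted_sq (φ := φ) (ψ := ψ) (X := S.ux x t) (y := S.u x t) hkj hj0 hμv
  have hw1 := neg_mul_le_weighted_sq (φ := φ) (ψ := ψ) (X := S.w₁x x t) (y := S.w₁ x t) hkj hj0 hv'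
  have hw2 := neg_mul_le_weighted_sq (φ := φ) (ψ := ψ) (X := S.w₂x x t) (y := S.w₂ x t) hkj hj0 hv'
  have hb1 := neg_mul_le_weighted_sq (φ := φ) (ψ := ψ) (X := S.b₁x x t) (y := S.b₁ x t) hkj hj0 hv'
  have hb2 := neg_mul_le_weighted_sq (φ := φ) (ψ := ψ) (X := S.b₂x x t) (y := S.b₂ x t) hkj hj0 hv'
  have hm2 : 0 ≤ S.θ x t ^ β / S.v x t := by positivity
  have hj2 : 0 ≤ S.θ x t ^ (p + 1) * p⁻¹ := by positivity
  have ht : -(φ * ψ * ((1 - k) * (S.θ x t ^ β / S.v x t * S.θx x t)))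
      ≤ φ ^ 2 * (p * S.θ x t ^ (β - p - 1) * S.θx x t ^ 2 / S.v x t) / 2
        + ψ ^ 2 * ((1 - k) ^ 2 * (S.θ x t ^ β / S.v x t) * (S.θ x t ^ (p + 1) * p⁻¹)) / 2 := by
    rcases hp.eq_or_lt with rfl | hp
    · simp [hk]
    · have h := neg_mul_le_weighted_sq (φ := φ) (ψ := ψ) (X := S.θx x t) (y := 1 - k)
        (k := p * S.θ x t ^ (-p - 1)) (j := S.θ x t ^ (p + 1) * p⁻¹) (by
          have : S.θ x t ^ (-p - 1) * S.θ x t ^ (p + 1) = 1 := by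
            rw [← Real.rpow_add hθ]; simp
          rw [show p * S.θ x t ^ (-p - 1) * (S.θ x t ^ (p + 1) * p⁻¹)
            = p * p⁻¹ * (S.θ x t ^ (-p - 1) * S.θ x t ^ (p + 1)) by ring, this,
            mul_inv_cancel₀ hp.ne', one_mul]) hj2 hm2
      have h6 : S.θ x t ^ (β - p - 1) = S.θ x t ^ (-p - 1) * S.θ x t ^ β := by
        rw [← Real.rpow_add hθ]; ring_nf
      rw [h6]
      refine h.trans_eq ?_
      ring
  obtain ⟨c, hc⟩ : ∃ c, c = S.u x t * (1 - S.θ x t / S.v x t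
    - (S.b₁ x t ^ 2 + S.b₂ x t ^ 2) / 2) := ⟨_, rfl⟩
  obtain ⟨d, hd⟩ : ∃ d, d = S.w₁ x t * S.b₁ x t + S.w₂ x t * S.b₂ x t := ⟨_, rfl⟩
  obtain ⟨e, he⟩ : ∃ e, e = S.u x t ^ 2 * (visc α (S.v x t) / S.v x t) * j
    + (S.w₁ x t ^ 2 + S.w₂ x t ^ 2 + (S.b₁ x t ^ 2 + S.b₂ x t ^ 2)) * (S.v x t)⁻¹ * j
    + (1 - k) ^ 2 * (S.θ x t ^ β / S.v x t) * (S.θ x t ^ (p + 1) * p⁻¹) := ⟨_, rfl⟩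
  have he0 : 0 ≤ e := by rw [he]; positivity
  have hφψ : |φ * ψ| ≤ 4 / R := by
    rw [abs_mul, abs_of_nonneg hφ0]
    exact (mul_le_of_le_one_left (abs_nonneg ψ) hφ1).trans hψa
  have hlin : ∀ c : ℝ, -(φ * ψ * c) ≤ 4 / R * |c| := fun c => by
    refine (neg_le_abs _).trans ?_
    rw [abs_mul]
    gcongr
  have hc' := hlin c
  have hd' := hlin d
  have he' : ψ ^ 2 * e ≤ 4 / R * e := by gcongr
  have hcE : S.cutErr p x t = e / 2 + |c| + |d| := by
    rw [cutErr, he, hc, hd, hk, hj]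
  have hflux : S.flux p x t = S.u x t * (visc α (S.v x t) / S.v x t * S.ux x t)
      + S.w₁ x t * ((S.v x t)⁻¹ * S.w₁x x t) + S.w₂ x t * ((S.v x t)⁻¹ * S.w₂x x t)
      + S.b₁ x t * ((S.v x t)⁻¹ * S.b₁x x t) + S.b₂ x t * ((S.v x t)⁻¹ * S.b₂x x t)
      + (1 - k) * (S.θ x t ^ β / S.v x t * S.θx x t) + c + d := by
    rw [flux, hc, hd, hk]
    ring
  have hdiss : S.diss p x t = k * (visc α (S.v x t) / S.v x t) * S.ux x t ^ 2
      + k * (S.v x t)⁻¹ * S.w₁x x t ^ 2 + k * (S.v x t)⁻¹ * S.w₂x x t ^ 2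
      + k * (S.v x t)⁻¹ * S.b₁x x t ^ 2 + k * (S.v x t)⁻¹ * S.b₂x x t ^ 2
      + p * S.θ x t ^ (β - p - 1) * S.θx x t ^ 2 / S.v x t := by
    rw [diss, heat, hk]
    ring
  rw [← hφ, ← hψ, hcE, hflux, hdiss, hcut]
  rw [he] at he' ⊢
  linarith

theorem source_le (hα : 0 ≤ α) {p : ℝ} (hp : 0 ≤ p) (x t : ℝ) :
    S.source p x t ≤ S.diss p x t / 4 + S.rem p x t := by
  have hv := S.v_pos x t
  have hθ := S.θ_pos x t
  have hμ := S.one_le_visc hα x t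
  have h1 := S.heat_le_diss hp x t
  obtain ⟨k, hk⟩ : ∃ k, k = S.θ x t ^ (-p) := ⟨_, rfl⟩
  have hk0 : 0 < k := by rw [hk]; positivity
  have h2 : k * (S.ux x t ^ 2 / S.v x t) ≤ k * S.heat x t := by
    refine mul_le_mul_of_nonneg_left ?_ hk0.le
    unfold heat
    gcongr
    nlinarith [sq_nonneg (S.ux x t), sq_nonneg (S.w₁x x t), sq_nonneg (S.w₂x x t),
      sq_nonneg (S.b₁x x t), sq_nonneg (S.b₂x x t)]
  rw [← hk] at h1
  have h3 : 0 ≤ (k * S.ux x t / 2 - (k * S.θ x t - 1)) ^ 2 / (k * S.v x t) := by positivity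
  have h4 : S.source p x t = k * (S.ux x t ^ 2 / S.v x t) / 4 + S.rem p x t
      - (k * S.ux x t / 2 - (k * S.θ x t - 1)) ^ 2 / (k * S.v x t) := by
    rw [source, rem, remDens, ← hk]
    field_simp
    ring
  linarith

theorem integral_cutoff_energyRate_le (hα : 0 ≤ α) {p : ℝ} (hp : 0 ≤ p) {R : ℝ} (hR : 4 ≤ R)
    (t : ℝ) :
    ∫ x in (-R)..R, cutoff R x * S.energyRate p x t
      ≤ -(1 / 4 * ∫ x in (-R)..R, cutoff R x * S.diss p x t)
        + (∫ x in (-R)..R, cutoff R x * S.rem p x t)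
        + 4 / R * ∫ x in (-R)..R, S.cutErr p x t := by
  have hR0 : 0 < R := by linarith
  have hparts := intervalIntegral.integral_mul_deriv_eq_deriv_mul (a := -R) (b := R)
    (fun x _ => hasDerivAt_cutoff R x) (fun x _ => S.hasDerivAt_flux p x t)
    (Continuous.intervalIntegrable (by fun_prop) _ _)
    (Continuous.intervalIntegrable (by fun_prop) _ _)
  rw [(cutoff_self hR0.ne').1, (cutoff_self hR0.ne').2, zero_mul, zero_mul, sub_zero, zero_sub]
    at hparts
  have hpt : ∀ x ∈ Icc (-R) R, cutoff R x * S.energyRate p x t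
      ≤ cutoff R x * (S.energyRate p x t + S.diss p x t - S.source p x t)
        + ((1 - x ^ 2 / R ^ 2) * (-4 * x / R ^ 2) * S.flux p x t
        + (-(1 / 4 * (cutoff R x * S.diss p x t)) + cutoff R x * S.rem p x t
          + 4 / R * S.cutErr p x t)) := fun x hx => by
    have h1 := S.neg_cutoff_deriv_mul_flux_le hα hp hR hx t
    have h2 := mul_le_mul_of_nonneg_left (S.source_le hα hp x t) (cutoff_nonneg R x)
    linarith
  have h := integral_mono_cont (a := -R) (b := R) (by fun_prop) (by fun_prop) (by linarith) hpt
  have hii : ∀ g : ℝ → ℝ, Continuous g → IntervalIntegrable g volume (-R) R :=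
    fun g hg => hg.intervalIntegrable _ _
  refine h.trans_eq ?_
  rw [intervalIntegral.integral_add (hii _ (by fun_prop)) (hii _ (by fun_prop)),
    intervalIntegral.integral_add (hii _ (by fun_prop)) (hii _ (by fun_prop)),
    intervalIntegral.integral_add (hii _ (by fun_prop)) (hii _ (by fun_prop)),
    intervalIntegral.integral_add (hii _ (by fun_prop)) (hii _ (by fun_prop)),
    intervalIntegral.integral_neg, intervalIntegral.integral_const_mul,
    intervalIntegral.integral_const_mul, hparts]
  ring

theorem far_cutErr (p : ℝ) :
    Tendsto (fun a : ℝ × ℝ => S.cutErr p a.1 a.2) (cocompact ℝ ×ˢ ⊤) (nhds 0) := by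
  have hv := S.far_v
  have hu := S.far_u
  have hθ := S.far_θ
  have hw := ((S.far_w₁.pow 2).add (S.far_w₂.pow 2))
  have hb := ((S.far_b₁.pow 2).add (S.far_b₂.pow 2))
  have hr : ∀ q : ℝ, Tendsto (fun a : ℝ × ℝ => S.θ a.1 a.2 ^ q) (cocompact ℝ ×ˢ ⊤)
      (nhds ((1:ℝ) ^ q)) := fun q => hθ.rpow_const (Or.inl one_ne_zero)
  have hm : Tendsto (fun a : ℝ × ℝ => visc α (S.v a.1 a.2)) (cocompact ℝ ×ˢ ⊤)
      (nhds (visc α 1)) :=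
    ((hv.rpow_const (Or.inl one_ne_zero)).const_mul α).const_add 1
  have h1 := ((hu.pow 2).mul (hm.div hv one_ne_zero)).mul (hr p)
  have h2 := ((hw.add hb).mul (hv.inv₀ one_ne_zero)).mul (hr p)
  have h3 := ((((hr (-p)).const_sub 1).pow 2).mul ((hr β).div hv one_ne_zero)).mul
    ((hr (p + 1)).mul_const p⁻¹)
  have h4 := (hu.mul (((hθ.div hv one_ne_zero).const_sub 1).sub (hb.div_const 2))).abs
  have h5 := ((S.far_w₁.mul S.far_b₁).add (S.far_w₂.mul S.far_b₂)).abs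
  have h := ((((h1.add h2).add h3).div_const 2).add h4).add h5
  simpa [cutErr] using h

theorem integral_cutoff_energy_sub (p : ℝ) {R t : ℝ} (ht : t ∈ Icc 0 T) :
    (∫ x in (-R)..R, cutoff R x * S.energy p x t) - ∫ x in (-R)..R, cutoff R x * S.energy p x 0
      = ∫ s in (0:ℝ)..t, ∫ x in (-R)..R, cutoff R x * S.energyRate p x s := by
  rw [integral_swap_cont (f := fun x s => cutoff R x * S.energyRate p x s) (by fun_prop),
    ← intervalIntegral.integral_sub (Continuous.intervalIntegrable (by fun_prop) _ _)
      (Continuous.intervalIntegrable (by fun_prop) _ _)]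
  refine intervalIntegral.integral_congr fun x _ => ?_
  rw [intervalIntegral.integral_const_mul, intervalIntegral.integral_eq_sub_of_hasDerivAt_of_le
    ht.1 (Continuous.continuousOn (by fun_prop : Continuous fun s => S.energy p x s))
    (fun s hs => S.hasDerivAt_energy p x ⟨hs.1, hs.2.trans_le ht.2⟩)
    (Continuous.intervalIntegrable (by fun_prop) _ _)]
  ring

/-- Energy inequality localized to `[-R, R]`. -/
theorem local_energy (hα : 0 ≤ α) (hT : 0 < T) {p : ℝ} (hp : 0 ≤ p) :
    ∃ R₀, ∀ R ≥ R₀, ∀ t ∈ Icc 0 T,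
      (∫ x in (-R)..R, cutoff R x * S.energy p x t)
        + 1 / 4 * (∫ s in (0:ℝ)..t, ∫ x in (-R)..R, cutoff R x * S.diss p x s)
      ≤ (∫ x in (-R)..R, cutoff R x * S.energy p x 0)
        + (∫ s in (0:ℝ)..t, ∫ x in (-R)..R, cutoff R x * S.rem p x s) + 1 := by
  obtain ⟨R₁, hR₁⟩ := exists_integral_le_mul (f := fun x t => S.cutErr p x t) (by fun_prop)
    (S.far_cutErr p) T (κ := 1 / (4 * T)) (by positivity)
  refine ⟨max R₁ 4, fun R hR t ht => ?_⟩
  have hR4 : 4 ≤ R := (le_max_right _ _).trans hR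
  have hR0 : 0 < R := by linarith
  have hsub := S.integral_cutoff_energy_sub p (R := R) ht
  have hmono := integral_mono_cont (a := 0) (b := t)
    (f := fun s => ∫ x in (-R)..R, cutoff R x * S.energyRate p x s)
    (g := fun s => -(1 / 4 * ∫ x in (-R)..R, cutoff R x * S.diss p x s)
        + (∫ x in (-R)..R, cutoff R x * S.rem p x s) + 1 / T) (by fun_prop) (by fun_prop) ht.1
    fun s hs => by
      refine (S.integral_cutoff_energyRate_le hα hp hR4 s).trans ?_
      gcongr
      have h := hR₁ R ((le_max_left _ _).trans hR) s ⟨hs.1, hs.2.trans ht.2⟩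
      calc _ ≤ 4 / R * (1 / (4 * T) * R) := by gcongr
        _ = 1 / T := by field_simp
  have hii : ∀ g : ℝ → ℝ, Continuous g → IntervalIntegrable g volume 0 t :=
    fun g hg => hg.intervalIntegrable _ _
  rw [intervalIntegral.integral_add (hii _ (by fun_prop)) (hii _ (by fun_prop)),
    intervalIntegral.integral_add (hii _ (by fun_prop)) (hii _ (by fun_prop)),
    intervalIntegral.integral_neg, intervalIntegral.integral_const_mul,
    intervalIntegral.integral_const, smul_eq_mul, sub_zero] at hmono
  have : t * (1 / T) ≤ 1 := by
    rw [mul_one_div, div_le_one hT]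
    exact ht.2
  linarith

end MHDFlow

theorem integral_unit_le {f : ℝ → ℝ} (hf : Continuous f) (h0 : ∀ x, 0 ≤ f x) {C : ℝ}
    (h : ∀ N ≥ 0, ∫ x in (-N)..N, f x ≤ C) (a : ℝ) : ∫ x in a..(a + 1), f x ≤ C :=
  (integral_mono_interval_cont hf h0 (by linarith [neg_abs_le a]) (by linarith)
    (by linarith [le_abs_self a])).trans (h (|a| + 1) (by positivity))

theorem integral_le_two_mul_cutoff {f : ℝ → ℝ} (hf : Continuous f) (h0 : ∀ x, 0 ≤ f x) {N R : ℝ}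
    (hN : 0 ≤ N) (hR : 0 < R) (hNR : 2 * N ≤ R) :
    ∫ x in (-N)..N, f x ≤ 2 * ∫ x in (-R)..R, cutoff R x * f x := by
  have h1 := integral_mono_cont (a := -N) (b := N) hf
    (show Continuous fun x => 2 * (cutoff R x * f x) by fun_prop) (by linarith) fun x hx => by
      have := mul_le_mul_of_nonneg_right (half_le_cutoff hR hNR hx) (h0 x)
      linarith
  rw [intervalIntegral.integral_const_mul] at h1
  have h2 := integral_mono_interval_cont (a := -N) (b := N) (c := -R) (d := R)
    (show Continuous fun x => cutoff R x * f x by fun_prop)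
    (fun x => mul_nonneg (cutoff_nonneg R x) (h0 x)) (by linarith) (by linarith) (by linarith)
  linarith

namespace MHDFlow

variable {α β T K δ : ℝ}

theorem v_initial_le (S : MHDFlow α β T K δ) (x : ℝ) : S.v x 0 ≤ K ^ 2 + 2 := by
  obtain ⟨y, hy, hy'⟩ := exists_le_integral_unit
    (show Continuous fun x => (S.v x 0 - 1) ^ 2 by fun_prop) x
  have hd : ∀ y, HasDerivAt (fun x => (S.v x 0 - 1) ^ 2) (2 * (S.v y 0 - 1) * S.vx y 0) y :=
    fun y => (((S.dx_v y 0).sub_const 1).fun_pow 2).congr_deriv (by norm_num)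
  have h1 := le_add_integral_abs_deriv hd (by fun_prop) (a := x) ⟨le_rfl, by linarith⟩ hy
  have h2 := integral_mono_cont (a := x) (b := x + 1)
    (f := fun s => |2 * (S.v s 0 - 1) * S.vx s 0|)
    (g := fun s => (S.v s 0 - 1) ^ 2 + S.vx s 0 ^ 2)
    (by fun_prop) (by fun_prop) (by linarith) fun s _ => by
      rw [abs_le]
      constructor <;> nlinarith [sq_nonneg (S.v s 0 - 1 - S.vx s 0),
        sq_nonneg (S.v s 0 - 1 + S.vx s 0)]
  have h3 := integral_unit_le (C := K ^ 2) (f := fun s => (S.v s 0 - 1) ^ 2 + S.vx s 0 ^ 2)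
    (by fun_prop) (fun _ => by positivity) (fun N hN => by
      refine (integral_mono_cont (by fun_prop) (by fun_prop) (by linarith) fun s _ => ?_).trans
        (S.initial N hN)
      have : 0 ≤ S.u s 0 ^ 2 + (S.θ s 0 - 1) ^ 2 + (S.b₁ s 0 ^ 2 + S.b₂ s 0 ^ 2)
        + (S.w₁ s 0 ^ 2 + S.w₂ s 0 ^ 2) := by positivity
      linarith) x
  have h4 := integral_mono_cont (a := x) (b := x + 1) (f := fun s => (S.v s 0 - 1) ^ 2)
    (g := fun s => (S.v s 0 - 1) ^ 2 + S.vx s 0 ^ 2)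
    (by fun_prop) (by fun_prop) (by linarith) fun s _ => by
      linarith [sq_nonneg (S.vx s 0)]
  nlinarith [sq_nonneg (S.v x 0 - 2)]

theorem exists_energy_initial_le (α β T K : ℝ) {δ : ℝ} (hδ : 0 < δ) (hδ1 : δ ≤ 1) {p : ℝ}
    (hp : 0 ≤ p) :
    ∃ C > 0, ∀ S : MHDFlow α β T K δ, ∀ R ≥ 0, ∫ x in (-R)..R, S.energy p x 0 ≤ C := by
  obtain ⟨c, hc⟩ : ∃ c, c = δ ^ (-1 - 1 : ℝ) := ⟨_, rfl⟩
  obtain ⟨d, hd⟩ : ∃ d, d = p * δ ^ (-p - 1) := ⟨_, rfl⟩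
  have hc0 : 0 < c := by rw [hc]; positivity
  have hd0 : 0 ≤ d := by rw [hd]; positivity
  refine ⟨(K ^ 2 + 2 + c + d) * K ^ 2 + 1, by positivity, fun S R hR => ?_⟩
  have h := integral_mono_cont (a := -R) (b := R) (f := fun x => S.energy p x 0)
    (g := fun x => (K ^ 2 + 2 + c + d) * ((S.v x 0 - 1) ^ 2 + S.u x 0 ^ 2 + (S.θ x 0 - 1) ^ 2
    + (S.b₁ x 0 ^ 2 + S.b₂ x 0 ^ 2) + (S.w₁ x 0 ^ 2 + S.w₂ x 0 ^ 2) + S.vx x 0 ^ 2))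
    (by fun_prop) (by fun_prop) (by linarith) fun x _ => by
      have h1 := relEnt_le_sq zero_le_one hδ hδ1 (S.v_initial x)
      have h2 := relEnt_le_sq hp hδ hδ1 (S.θ_initial x)
      rw [← hc] at h1
      rw [← hd] at h2
      have hb : 0 ≤ S.b₁ x 0 ^ 2 + S.b₂ x 0 ^ 2 := by positivity
      have h3 := mul_le_mul_of_nonneg_right (S.v_initial_le x) hb
      have hu := sq_nonneg (S.u x 0)
      have hvv := sq_nonneg (S.v x 0 - 1)
      have hθθ := sq_nonneg (S.θ x 0 - 1)
      have hw : 0 ≤ S.w₁ x 0 ^ 2 + S.w₂ x 0 ^ 2 := by positivity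
      have hk := sq_nonneg K
      have hvx := sq_nonneg (S.vx x 0)
      unfold energy
      have h4 : S.v x 0 * (S.b₁ x 0 ^ 2 + S.b₂ x 0 ^ 2) / 2
        ≤ (K ^ 2 + 2 + c + d) * (S.b₁ x 0 ^ 2 + S.b₂ x 0 ^ 2) := by
          nlinarith [mul_nonneg hc0.le hb, mul_nonneg hd0 hb, mul_nonneg hk hb]
      have h5 : relEnt 1 (S.v x 0) ≤ (K ^ 2 + 2 + c + d) * (S.v x 0 - 1) ^ 2 := by
          nlinarith [mul_nonneg hd0 hvv, mul_nonneg hk hvv]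
      have h6 : relEnt p (S.θ x 0) ≤ (K ^ 2 + 2 + c + d) * (S.θ x 0 - 1) ^ 2 := by
          nlinarith [mul_nonneg hc0.le hθθ, mul_nonneg hk hθθ]
      have h7 : ∀ z, 0 ≤ z → z / 2 ≤ (K ^ 2 + 2 + c + d) * z := fun z hz => by
          nlinarith [mul_nonneg hc0.le hz, mul_nonneg hk hz, mul_nonneg hd0 hz]
      have h8 := h7 _ hu
      have h9 := h7 _ hw
      have h10 := h7 _ hvx
      linarith
  rw [intervalIntegral.integral_const_mul] at h
  have h' := mul_le_mul_of_nonneg_left (S.initial R hR)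
    (show 0 ≤ K ^ 2 + 2 + c + d by positivity)
  linarith

theorem integral_cutoff_energy_initial_le (S : MHDFlow α β T K δ) {p R : ℝ} (hp : 0 ≤ p)
    (hR : 0 ≤ R) :
    ∫ x in (-R)..R, cutoff R x * S.energy p x 0 ≤ ∫ x in (-R)..R, S.energy p x 0 :=
  integral_mono_cont (by fun_prop) (by fun_prop) (by linarith) fun x hx =>
    mul_le_of_le_one_left (S.energy_nonneg hp x 0) (cutoff_le_one hx)

/-- Uniform bound on the energy with exponent `p`. -/
def EnergyBound (S : MHDFlow α β T K δ) (p C : ℝ) : Prop :=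
  ∀ t ∈ Icc 0 T, ∀ N ≥ 0, ∫ x in (-N)..N, S.energy p x t ≤ C

/-- Bound on the total dissipation with exponent `p`. -/
def DissBound (S : MHDFlow α β T K δ) (p C : ℝ) : Prop :=
  ∀ N ≥ 0, ∫ s in (0:ℝ)..T, ∫ x in (-N)..N, S.diss p x s ≤ C

theorem integral_cutoff_nonneg {f : ℝ → ℝ} (h : ∀ x, 0 ≤ f x) {R : ℝ} (hR : 0 ≤ R) :
    0 ≤ ∫ x in (-R)..R, cutoff R x * f x :=
  intervalIntegral.integral_nonneg (by linarith) fun x _ => mul_nonneg (cutoff_nonneg R x) (h x)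

theorem dissBound_of_cutoff (S : MHDFlow α β T K δ) (hα : 0 ≤ α) (hT : 0 < T) {p C : ℝ}
    (hp : 0 ≤ p)
    (h : ∃ R₀, ∀ R ≥ R₀, ∫ s in (0:ℝ)..T, ∫ x in (-R)..R, cutoff R x * S.diss p x s ≤ C) :
    S.DissBound p (2 * C) := fun N hN => by
  obtain ⟨R₀, h⟩ := h
  have hR0 : 0 < max R₀ (2 * N + 1) := lt_max_of_lt_right (by linarith)
  have h1 := h (max R₀ (2 * N + 1)) (le_max_left _ _)
  have h2 := integral_mono_cont (a := 0) (b := T) (f := fun s => ∫ x in (-N)..N, S.diss p x s)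
    (g := fun s => 2 * ∫ x in (-max R₀ (2 * N + 1))..(max R₀ (2 * N + 1)),
      cutoff (max R₀ (2 * N + 1)) x * S.diss p x s) (by fun_prop) (by fun_prop) hT.le
    fun s _ => integral_le_two_mul_cutoff (by fun_prop) (fun x => S.diss_nonneg hα hp x s) hN hR0
      ((by linarith : 2 * N ≤ 2 * N + 1).trans (le_max_right _ _))
  rw [intervalIntegral.integral_const_mul] at h2
  linarith

theorem energyBound_of_cutoff (S : MHDFlow α β T K δ) {p C : ℝ} (hp : 0 ≤ p)
    (h : ∃ R₀, ∀ R ≥ R₀, ∀ t ∈ Icc 0 T, ∫ x in (-R)..R, cutoff R x * S.energy p x t ≤ C) :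
    S.EnergyBound p (2 * C) := fun t ht N hN => by
  obtain ⟨R₀, h⟩ := h
  have hR0 : 0 < max R₀ (2 * N + 1) := lt_max_of_lt_right (by linarith)
  have h1 := h (max R₀ (2 * N + 1)) (le_max_left _ _) t ht
  have h2 := integral_le_two_mul_cutoff (f := fun x => S.energy p x t) (by fun_prop)
    (fun x => S.energy_nonneg hp x t) hN hR0
    ((by linarith : 2 * N ≤ 2 * N + 1).trans (le_max_right _ _))
  linarith

/-- The basic energy and entropy estimate. -/
theorem exists_entropy_bound (K : ℝ) (hα : 0 ≤ α) (hT : 0 < T) (hδ : 0 < δ) (hδ1 : δ ≤ 1) :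
    ∃ C > 0, ∀ S : MHDFlow α β T K δ, S.EnergyBound 1 C ∧ S.DissBound 1 C := by
  obtain ⟨C, hC, h0⟩ := exists_energy_initial_le α β T K hδ hδ1 zero_le_one
  have key : ∀ S : MHDFlow α β T K δ, ∃ R₀, ∀ R ≥ R₀, ∀ t ∈ Icc 0 T,
      (∫ x in (-R)..R, cutoff R x * S.energy 1 x t) ≤ C + 1 ∧
      ∫ s in (0:ℝ)..t, ∫ x in (-R)..R, cutoff R x * S.diss 1 x s ≤ 4 * (C + 1) := fun S => by
    obtain ⟨R₀, h⟩ := S.local_energy hα hT zero_le_one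
    refine ⟨max R₀ 0, fun R hR t ht => ?_⟩
    have hR0 : 0 ≤ R := (le_max_right _ _).trans hR
    have h1 := h R ((le_max_left _ _).trans hR) t ht
    simp only [S.rem_one, mul_zero, intervalIntegral.integral_zero] at h1
    have h2 := S.integral_cutoff_energy_initial_le zero_le_one hR0
    have h3 := h0 S R hR0
    have h4 := integral_cutoff_nonneg (fun x => S.energy_nonneg zero_le_one x t) hR0
    have h5 : 0 ≤ ∫ s in (0:ℝ)..t, ∫ x in (-R)..R, cutoff R x * S.diss 1 x s :=
      intervalIntegral.integral_nonneg ht.1 fun s _ =>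
        integral_cutoff_nonneg (fun x => S.diss_nonneg hα zero_le_one x s) hR0
    constructor <;> linarith
  refine ⟨2 * (4 * (C + 1)), by positivity, fun S => ⟨?_, ?_⟩⟩
  · obtain ⟨R₀, h⟩ := key S
    exact S.energyBound_of_cutoff zero_le_one
      ⟨R₀, fun R hR t ht => (h R hR t ht).1.trans (by linarith)⟩
  · obtain ⟨R₀, h⟩ := key S
    exact S.dissBound_of_cutoff hα hT zero_le_one
      ⟨R₀, fun R hR => (h R hR T ⟨hT.le, le_rfl⟩).2⟩

theorem EnergyBound.integral_le_of_le {S : MHDFlow α β T K δ} {C : ℝ} (hE : S.EnergyBound 1 C)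
    {t : ℝ} (ht : t ∈ Icc 0 T) {f : ℝ → ℝ} (hf : Continuous f) {c d : ℝ} (hc : 0 ≤ c)
    (h : ∀ x, f x ≤ c * S.energy 1 x t + d) (a : ℝ) :
    ∫ x in a..(a + 1), f x ≤ c * C + d := by
  have h1 := integral_mono_cont (a := a) (b := a + 1) hf
    (show Continuous fun x => c * S.energy 1 x t + d by fun_prop) (by linarith) fun x _ => h x
  rw [intervalIntegral.integral_add (Continuous.intervalIntegrable (by fun_prop) _ _)
    (Continuous.intervalIntegrable (by fun_prop) _ _), intervalIntegral.integral_const_mul,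
    intervalIntegral.integral_const, smul_eq_mul, add_sub_cancel_left, one_mul] at h1
  have h2 := integral_unit_le (f := fun x => S.energy 1 x t) (by fun_prop)
    (fun x => S.energy_nonneg zero_le_one x t) (hE t ht) a
  have := mul_le_mul_of_nonneg_left h2 hc
  linarith

theorem components_le_energy (S : MHDFlow α β T K δ) (x t : ℝ) :
    S.u x t ^ 2 ≤ 2 * S.energy 1 x t ∧
    S.v x t * (S.b₁ x t ^ 2 + S.b₂ x t ^ 2) ≤ 2 * S.energy 1 x t ∧
    relEnt 1 (S.v x t) ≤ S.energy 1 x t ∧ relEnt 1 (S.θ x t) ≤ S.energy 1 x t := by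
  have := S.v_pos x t
  have h1 := relEnt_nonneg zero_le_one (S.v_pos x t)
  have h2 := relEnt_nonneg zero_le_one (S.θ_pos x t)
  have h3 : 0 ≤ S.v x t * (S.b₁ x t ^ 2 + S.b₂ x t ^ 2) := by positivity
  have h4 : 0 ≤ S.w₁ x t ^ 2 + S.w₂ x t ^ 2 := by positivity
  have h5 := sq_nonneg (S.u x t)
  unfold energy
  refine ⟨?_, ?_, ?_, ?_⟩ <;> linarith

theorem EnergyBound.integral_v_le {S : MHDFlow α β T K δ} {C : ℝ} (hE : S.EnergyBound 1 C)
    {t : ℝ} (ht : t ∈ Icc 0 T) (a : ℝ) : ∫ x in a..(a + 1), S.v x t ≤ 2 * C + 2 :=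
  hE.integral_le_of_le ht (by fun_prop) zero_le_two (fun x => by
    linarith [le_relEnt_one (S.v_pos x t), (S.components_le_energy x t).2.2.1]) a

theorem EnergyBound.integral_θ_le {S : MHDFlow α β T K δ} {C : ℝ} (hE : S.EnergyBound 1 C)
    {t : ℝ} (ht : t ∈ Icc 0 T) (a : ℝ) : ∫ x in a..(a + 1), S.θ x t ≤ 2 * C + 2 :=
  hE.integral_le_of_le ht (by fun_prop) zero_le_two (fun x => by
    linarith [le_relEnt_one (S.θ_pos x t), (S.components_le_energy x t).2.2.2]) a

theorem EnergyBound.integral_magnetic_le {S : MHDFlow α β T K δ} {C : ℝ}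
    (hE : S.EnergyBound 1 C) {t : ℝ} (ht : t ∈ Icc 0 T) (a : ℝ) :
    ∫ x in a..(a + 1), S.v x t * (S.b₁ x t ^ 2 + S.b₂ x t ^ 2) ≤ 2 * C + 0 :=
  hE.integral_le_of_le ht (by fun_prop) zero_le_two (fun x => by
    linarith [(S.components_le_energy x t).2.1]) a

end MHDFlow

/-- Primitive of `z ↦ visc α z / z`. -/
def viscPot (α z : ℝ) : ℝ := Real.log z - z ^ (-α)

theorem hasDerivAt_viscPot (α : ℝ) {z : ℝ} (hz : 0 < z) :
    HasDerivAt (viscPot α) (visc α z / z) z := by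
  refine ((Real.hasDerivAt_log hz.ne').fun_sub
    (Real.hasDerivAt_rpow_const (p := -α) (Or.inl hz.ne'))).congr_deriv ?_
  rw [Real.rpow_sub hz, Real.rpow_one, visc]
  ring

theorem viscPot_mono {α y z : ℝ} (hα : 0 ≤ α) (hy : 0 < y) (hyz : y ≤ z) :
    viscPot α y ≤ viscPot α z := by
  have h1 := Real.log_le_log hy hyz
  have h2 := Real.rpow_le_rpow_of_nonpos hy hyz (neg_nonpos.2 hα)
  unfold viscPot
  linarith

theorem viscPot_le_log (α : ℝ) {z : ℝ} (hz : 0 < z) : viscPot α z ≤ Real.log z := by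
  have := Real.rpow_nonneg hz.le (-α)
  unfold viscPot
  linarith

theorem exp_viscPot_le (α : ℝ) {z : ℝ} (hz : 0 < z) : Real.exp (viscPot α z) ≤ z :=
  (Real.exp_le_exp.2 (viscPot_le_log α hz)).trans_eq (Real.exp_log hz)

theorem exists_le_exp_viscPot {α : ℝ} (hα : 0 ≤ α) {E : ℝ} (hE : 0 < E) :
    ∃ c > 0, ∀ z > 0, c * (1 - relEnt 1 z / (2 * E)) ≤ Real.exp (viscPot α z) := by
  refine ⟨Real.exp (viscPot α (Real.exp (-2 * E - 1))), Real.exp_pos _, fun z hz => ?_⟩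
  have h0 := relEnt_nonneg zero_le_one hz
  rcases le_total z (Real.exp (-2 * E - 1)) with h | h
  · have h1 : Real.log z ≤ -2 * E - 1 := by rwa [Real.log_le_iff_le_exp hz]
    have h2 : 2 * E ≤ relEnt 1 z := by rw [relEnt_one hz]; linarith
    have h3 : 1 ≤ relEnt 1 z / (2 * E) := by rw [one_le_div (by positivity)]; exact h2
    exact (mul_nonpos_of_nonneg_of_nonpos (Real.exp_pos _).le (by linarith)).trans
      (Real.exp_pos _).le
  · refine (mul_le_of_le_one_right (Real.exp_pos _).le ?_).trans
      (Real.exp_le_exp.2 (viscPot_mono hα (Real.exp_pos _) h))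
    have : 0 ≤ relEnt 1 z / (2 * E) := by positivity
    linarith

theorem continuousOn_viscPot (α : ℝ) : ContinuousOn (viscPot α) (Ioi 0) := fun _ hz =>
  (hasDerivAt_viscPot α hz).continuousAt.continuousWithinAt

namespace MHDFlow

variable {α β T K δ : ℝ} (S : MHDFlow α β T K δ)

@[fun_prop] theorem cont_viscPot {X : Type*} [TopologicalSpace X] {f g : X → ℝ}
    (hf : Continuous f) (hg : Continuous g) :
    Continuous fun a => viscPot α (S.v (f a) (g a)) :=
  (continuousOn_viscPot α).comp_continuous (S.cont_v hf hg) fun _ => S.v_pos _ _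

/-- Total pressure. -/
def pres (x t : ℝ) : ℝ := S.θ x t / S.v x t + (S.b₁ x t ^ 2 + S.b₂ x t ^ 2) / 2

@[fun_prop] theorem cont_pres {X : Type*} [TopologicalSpace X] {f g : X → ℝ}
    (hf : Continuous f) (hg : Continuous g) :
    Continuous fun a => S.pres (f a) (g a) := by
  unfold pres
  fun_prop (disch := intros; simp)

theorem pres_nonneg (x t : ℝ) : 0 ≤ S.pres x t := by
  have := S.v_pos x t
  have := S.θ_pos x t
  unfold pres
  positivity

/-- Accumulated pressure. -/
def accPres (x t : ℝ) : ℝ := ∫ s in (0:ℝ)..t, S.pres x s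

theorem accPres_nonneg (x : ℝ) {t : ℝ} (ht : 0 ≤ t) : 0 ≤ S.accPres x t :=
  intervalIntegral.integral_nonneg ht fun s _ => S.pres_nonneg x s

@[fun_prop] theorem cont_accPres {X : Type*} [TopologicalSpace X] {f g : X → ℝ}
    (hf : Continuous f) (hg : Continuous g) :
    Continuous fun a => S.accPres (f a) (g a) := by
  have h : Continuous fun p : ℝ × ℝ => S.accPres p.1 p.2 :=
    intervalIntegral.continuous_parametric_intervalIntegral_of_continuous
      (f := fun (p : ℝ × ℝ) s => S.pres p.1 s) (by fun_prop) continuous_snd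
  exact h.comp (hf.prodMk hg)

theorem hasDerivAt_accPres (x t : ℝ) : HasDerivAt (fun t => S.accPres x t) (S.pres x t) t :=
  intervalIntegral.integral_hasDerivAt_right (Continuous.intervalIntegrable (by fun_prop) _ _)
    (Continuous.stronglyMeasurableAtFilter (by fun_prop) _ _) (by fun_prop)

/-- Effective viscous potential, whose spatial increments are increments of momentum. -/
def effPot (x t : ℝ) : ℝ := viscPot α (S.v x t) - viscPot α (S.v x 0) - S.accPres x t

@[fun_prop] theorem cont_effPot {X : Type*} [TopologicalSpace X] {f g : X → ℝ}
    (hf : Continuous f) (hg : Continuous g) :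
    Continuous fun a => S.effPot (f a) (g a) := by
  unfold effPot
  fun_prop

theorem integral_viscous_stress (x : ℝ) {t : ℝ} (ht : t ∈ Icc 0 T) :
    ∫ s in (0:ℝ)..t, (visc α (S.v x s) * S.ux x s / S.v x s - S.pres x s) = S.effPot x t := by
  rw [intervalIntegral.integral_eq_sub_of_hasDerivAt_of_le
    (f := fun s => viscPot α (S.v x s) - S.accPres x s) ht.1
    (Continuous.continuousOn (by fun_prop))
    (fun s hs => ?_) (Continuous.intervalIntegrable (by fun_prop (disch := intros; simp)) _ _)]
  · simp only [effPot, accPres, intervalIntegral.integral_same]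
    ring
  · refine (((hasDerivAt_viscPot α (S.v_pos x s)).comp s
      (S.dt_v x s ⟨hs.1, hs.2.trans_le ht.2⟩)).fun_sub (S.hasDerivAt_accPres x s)).congr_deriv ?_
    ring

theorem effPot_sub (x z : ℝ) {t : ℝ} (ht : t ∈ Icc 0 T) :
    S.effPot z t - S.effPot x t = ∫ y in x..z, (S.u y t - S.u y 0) := by
  have h1 : ∀ y, ∫ s in (0:ℝ)..t, S.ut y s = S.u y t - S.u y 0 := fun y =>
    intervalIntegral.integral_eq_sub_of_hasDerivAt_of_le ht.1
      (Continuous.continuousOn (by fun_prop : Continuous fun s => S.u y s))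
      (fun s hs => S.dt_u y s ⟨hs.1, hs.2.trans_le ht.2⟩)
      (Continuous.intervalIntegrable (by fun_prop) _ _)
  have h2 : ∀ s, ∫ y in x..z, S.ut y s = (visc α (S.v z s) * S.ux z s / S.v z s - S.pres z s)
      - (visc α (S.v x s) * S.ux x s / S.v x s - S.pres x s) := fun s =>
    intervalIntegral.integral_eq_sub_of_hasDerivAt (fun y _ => S.momentum y s)
      (Continuous.intervalIntegrable (by fun_prop) _ _)
  rw [← S.integral_viscous_stress z ht, ← S.integral_viscous_stress x ht,
    ← intervalIntegral.integral_sub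
      (Continuous.intervalIntegrable (by fun_prop (disch := intros; simp)) _ _)
      (Continuous.intervalIntegrable (by fun_prop (disch := intros; simp)) _ _)]
  simp_rw [← h1, ← h2]
  exact integral_swap_cont (f := fun y s => S.ut y s) (by fun_prop) _ _ _ _

theorem hasDerivAt_effPot (x : ℝ) {t : ℝ} (ht : t ∈ Icc 0 T) :
    HasDerivAt (fun y => S.effPot y t) (S.u x t - S.u x 0) x := by
  have h : (fun y => S.effPot y t)
      = fun y => S.effPot 0 t + ∫ z in (0:ℝ)..y, (S.u z t - S.u z 0) := by
    funext y
    rw [← S.effPot_sub 0 y ht]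
    ring
  rw [h]
  exact (intervalIntegral.integral_hasDerivAt_right
    (Continuous.intervalIntegrable (by fun_prop) _ _)
    (Continuous.stronglyMeasurableAtFilter (by fun_prop) _ _)
    (by fun_prop)).const_add _

variable {S}

theorem EnergyBound.effPot_le {C : ℝ} (hE : S.EnergyBound 1 C) {t : ℝ} (ht : t ∈ Icc 0 T)
    {a x z : ℝ} (hx : x ∈ Icc a (a + 1)) (hz : z ∈ Icc a (a + 1)) :
    S.effPot x t ≤ S.effPot z t + (2 * C + 1) := by
  have h1 := le_add_integral_abs_deriv (fun y => S.hasDerivAt_effPot y ht) (by fun_prop) hx hz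
  have hu : ∀ t y, |S.u y t| ≤ 1 * S.energy 1 y t + 1 / 2 := fun t y => by
    have h := (S.components_le_energy y t).1
    have : |S.u y t| ≤ (S.u y t ^ 2 + 1) / 2 := by
      rw [← sq_abs]
      nlinarith [sq_nonneg (|S.u y t| - 1)]
    linarith
  have h2 := integral_mono_cont (a := a) (b := a + 1) (f := fun y => |S.u y t - S.u y 0|)
    (g := fun y => |S.u y t| + |S.u y 0|) (by fun_prop) (by fun_prop) (by linarith)
    fun y _ => abs_sub _ _
  rw [intervalIntegral.integral_add (Continuous.intervalIntegrable (by fun_prop) _ _)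
    (Continuous.intervalIntegrable (by fun_prop) _ _)] at h2
  have h3 := hE.integral_le_of_le ht (by fun_prop) zero_le_one (hu t) a
  have h4 := hE.integral_le_of_le ⟨le_rfl, ht.1.trans ht.2⟩ (by fun_prop) zero_le_one (hu 0) a
  linarith

theorem exp_accPres_eq (S : MHDFlow α β T K δ) (x t : ℝ) :
    Real.exp (S.accPres x t) = Real.exp (viscPot α (S.v x t))
      * Real.exp (-viscPot α (S.v x 0)) * Real.exp (-S.effPot x t) := by
  rw [← Real.exp_add, ← Real.exp_add, effPot]
  ring_nf

theorem exp_accPres_eq_integral (S : MHDFlow α β T K δ) (x t : ℝ) :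
    Real.exp (S.accPres x t) = 1 + ∫ s in (0:ℝ)..t, S.pres x s * Real.exp (S.accPres x s) := by
  rw [intervalIntegral.integral_eq_sub_of_hasDerivAt
    (f := fun s => Real.exp (S.accPres x s))
    (fun s _ => (S.hasDerivAt_accPres x s).exp.congr_deriv (mul_comm _ _))
    (Continuous.intervalIntegrable (by fun_prop) _ _)]
  simp [accPres]

/-- Uniform lower bound for the specific volume. -/
theorem exists_le_v (β K : ℝ) (hα : 0 ≤ α) (hδ : 0 < δ) {E : ℝ} (hE0 : 0 < E) :
    ∃ c > 0, ∀ S : MHDFlow α β T K δ, S.EnergyBound 1 E → ∀ t ∈ Icc 0 T, ∀ x, c ≤ S.v x t := by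
  obtain ⟨c₁, hc₁, hF⟩ := exists_le_exp_viscPot hα hE0
  obtain ⟨A, hA⟩ : ∃ A, A = 2 * E + 1 := ⟨_, rfl⟩
  obtain ⟨d, hd⟩ : ∃ d, d = Real.exp (-viscPot α δ) := ⟨_, rfl⟩
  have hd0 : 0 < d := by rw [hd]; positivity
  obtain ⟨B, hB⟩ : ∃ B, B = (K ^ 2 + 2) * Real.exp A * (2 / c₁) := ⟨_, rfl⟩
  have hB0 : 0 < B := by rw [hB]; positivity
  obtain ⟨D, hD⟩ : ∃ D, D = B * (d * Real.exp A * (4 * E + 2)) := ⟨_, rfl⟩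
  have hD0 : 0 < D := by rw [hD]; positivity
  refine ⟨(B * Real.exp (D * T))⁻¹ * d⁻¹, by positivity, fun S hE t₀ ht₀ a => ?_⟩
  have hv0 : ∀ x, Real.exp (-viscPot α (S.v x 0)) ≤ d := fun x => by
    rw [hd]
    exact Real.exp_le_exp.2 (neg_le_neg (viscPot_mono hα hδ (S.v_initial x)))
  have hgrow : ∀ t ∈ Icc 0 T, ∀ x ∈ Icc a (a + 1), Real.exp (S.accPres x t)
      ≤ 1 + ∫ s in (0:ℝ)..t, d * Real.exp A * Real.exp (-S.effPot a s)
        * (S.θ x s + S.v x s * (S.b₁ x s ^ 2 + S.b₂ x s ^ 2) / 2) := fun t ht x hx => by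
    rw [S.exp_accPres_eq_integral]
    gcongr
    refine integral_mono_cont (by fun_prop) (by fun_prop) ht.1 fun s hs => ?_
    have hL := hE.effPot_le ⟨hs.1, hs.2.trans ht.2⟩ (x := a) (z := x) (a := a)
      ⟨le_rfl, by linarith⟩ hx
    rw [← hA] at hL
    have h1 : Real.exp (-S.effPot x s) ≤ Real.exp A * Real.exp (-S.effPot a s) := by
      rw [← Real.exp_add]
      exact Real.exp_le_exp.2 (by linarith)
    have h2 : S.pres x s * Real.exp (viscPot α (S.v x s))
        ≤ S.θ x s + S.v x s * (S.b₁ x s ^ 2 + S.b₂ x s ^ 2) / 2 := by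
      refine (mul_le_mul_of_nonneg_left (exp_viscPot_le α (S.v_pos x s))
        (S.pres_nonneg x s)).trans_eq ?_
      rw [pres]
      field_simp [S.v_ne x s]
    have h3 : 0 ≤ S.θ x s + S.v x s * (S.b₁ x s ^ 2 + S.b₂ x s ^ 2) / 2 := by
      have := S.v_pos x s
      have := S.θ_pos x s
      positivity
    rw [S.exp_accPres_eq]
    calc S.pres x s * (Real.exp (viscPot α (S.v x s)) * Real.exp (-viscPot α (S.v x 0))
          * Real.exp (-S.effPot x s))
        = S.pres x s * Real.exp (viscPot α (S.v x s)) * Real.exp (-viscPot α (S.v x 0))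
          * Real.exp (-S.effPot x s) := by ring
      _ ≤ (S.θ x s + S.v x s * (S.b₁ x s ^ 2 + S.b₂ x s ^ 2) / 2) * d
          * (Real.exp A * Real.exp (-S.effPot a s)) := by
        gcongr
        exact hv0 x
      _ = _ := by ring
  have hZ : ∀ t ∈ Icc 0 T, ∫ x in a..(a + 1), Real.exp (S.accPres x t)
      ≤ 1 + d * Real.exp A * (4 * E + 2) * ∫ s in (0:ℝ)..t, Real.exp (-S.effPot a s) :=
      fun t ht => by
    have h1 := integral_mono_cont (a := a) (b := a + 1) (by fun_prop) (by fun_prop) (by linarith)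
      (hgrow t ht)
    rw [intervalIntegral.integral_add (Continuous.intervalIntegrable (by fun_prop) _ _)
      (Continuous.intervalIntegrable (by fun_prop) _ _), intervalIntegral.integral_const,
      smul_eq_mul, add_sub_cancel_left, one_mul, ← integral_swap_cont (f := fun x s =>
        d * Real.exp A * Real.exp (-S.effPot a s)
        * (S.θ x s + S.v x s * (S.b₁ x s ^ 2 + S.b₂ x s ^ 2) / 2)) (by fun_prop)] at h1
    refine h1.trans ?_
    rw [← intervalIntegral.integral_const_mul]
    gcongr
    refine integral_mono_cont (by fun_prop) (by fun_prop) ht.1 fun s hs => ?_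
    have hs' : s ∈ Icc 0 T := ⟨hs.1, hs.2.trans ht.2⟩
    rw [intervalIntegral.integral_const_mul, intervalIntegral.integral_add
      (Continuous.intervalIntegrable (by fun_prop) _ _)
      (Continuous.intervalIntegrable (by fun_prop) _ _), intervalIntegral.integral_div]
    have h2 := hE.integral_θ_le hs' a
    have h3 := hE.integral_magnetic_le hs' a
    calc _ ≤ d * Real.exp A * Real.exp (-S.effPot a s) * (4 * E + 2) :=
          mul_le_mul_of_nonneg_left (by linarith) (by positivity)
      _ = _ := by ring
  have hlow : ∀ t ∈ Icc 0 T, Real.exp (-S.effPot a t)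
      ≤ B * ∫ x in a..(a + 1), Real.exp (S.accPres x t) := fun t ht => by
    have h1 := integral_mono_cont (a := a) (b := a + 1)
      (f := fun x => c₁ * (1 - relEnt 1 (S.v x t) / (2 * E)))
      (g := fun x => (K ^ 2 + 2) * Real.exp A * Real.exp (S.effPot a t)
        * Real.exp (S.accPres x t)) (by fun_prop) (by fun_prop) (by linarith) fun x hx => by
      refine (hF _ (S.v_pos x t)).trans ?_
      have hL := hE.effPot_le ht hx (z := a) ⟨le_rfl, by linarith⟩
      have h2 : Real.exp (viscPot α (S.v x t)) = Real.exp (viscPot α (S.v x 0))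
        * Real.exp (S.effPot x t) * Real.exp (S.accPres x t) := by
        rw [← Real.exp_add, ← Real.exp_add, effPot]
        ring_nf
      rw [h2]
      have h3 : Real.exp (S.effPot x t) ≤ Real.exp A * Real.exp (S.effPot a t) := by
        rw [← Real.exp_add]
        exact Real.exp_le_exp.2 (by linarith)
      rw [mul_assoc (K ^ 2 + 2)]
      gcongr
      exact (exp_viscPot_le α (S.v_pos x 0)).trans (S.v_initial_le x)
    have h4 := hE.integral_le_of_le ht (f := fun x => relEnt 1 (S.v x t)) (by fun_prop)
      zero_le_one (d := 0) (fun x => by linarith [(S.components_le_energy x t).2.2.1]) a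
    rw [intervalIntegral.integral_const_mul, intervalIntegral.integral_const_mul,
      intervalIntegral.integral_sub (Continuous.intervalIntegrable (by fun_prop) _ _)
      (Continuous.intervalIntegrable (by fun_prop) _ _), intervalIntegral.integral_const,
      smul_eq_mul, add_sub_cancel_left, one_mul, intervalIntegral.integral_div] at h1
    have h5 : (∫ x in a..(a + 1), relEnt 1 (S.v x t)) / (2 * E) ≤ 1 / 2 := by
      rw [div_le_iff₀ (by positivity)]
      linarith
    have h6 : c₁ / 2 ≤ (K ^ 2 + 2) * Real.exp A * Real.exp (S.effPot a t)
        * ∫ x in a..(a + 1), Real.exp (S.accPres x t) := by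
      refine le_trans ?_ h1
      rw [div_eq_mul_one_div]
      gcongr
      linarith
    rw [Real.exp_neg, inv_le_iff_one_le_mul₀ (Real.exp_pos _), hB]
    calc 1 = c₁ / 2 * (2 / c₁) := by field_simp
      _ ≤ _ := mul_le_mul_of_nonneg_right h6 (by positivity)
      _ = _ := by ring
  have hfin := gronwall_integral (f := fun t => Real.exp (-S.effPot a t)) (by fun_prop)
    (A := B) hD0.le (fun t ht => by
      refine (hlow t ht).trans ((mul_le_mul_of_nonneg_left (hZ t ht) hB0.le).trans_eq ?_)
      rw [hD]
      ring) ht₀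
  have hfin' : Real.exp (-S.effPot a t₀) ≤ B * Real.exp (D * T) := by
    refine hfin.trans ?_
    gcongr
    exact ht₀.2
  have h7 := S.exp_accPres_eq a t₀
  have h8 : 1 ≤ Real.exp (S.accPres a t₀) := Real.one_le_exp (S.accPres_nonneg a ht₀.1)
  have h9 : 1 ≤ S.v a t₀ * d * (B * Real.exp (D * T)) := by
    refine h8.trans (h7.trans_le ?_)
    have := S.v_pos a t₀
    gcongr
    · exact exp_viscPot_le α (S.v_pos _ _)
    · exact hv0 a
  rw [← mul_inv, inv_le_iff_one_le_mul₀ (by positivity)]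
  linarith

/-- Pointwise bound of the temperature by the local dissipation. -/
theorem exists_θ_rpow_le (T K δ : ℝ) (hα : 0 ≤ α) {p : ℝ} (hp : 0 < p) (hpβ : p < β + 1) {E : ℝ}
    (hE0 : 0 < E) :
    ∃ C > 0, ∀ S : MHDFlow α β T K δ, S.EnergyBound 1 E → ∀ t ∈ Icc 0 T, ∀ a,
      ∀ x ∈ Icc a (a + 1), S.θ x t ^ (β + 1 - p) ≤ C * (1 + ∫ y in a..(a + 1), S.diss p y t) := by
  obtain ⟨γ, hγ⟩ : ∃ γ, γ = (β + 1 - p) / 2 := ⟨_, rfl⟩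
  have hγ0 : 0 < γ := by rw [hγ]; linarith
  obtain ⟨c, hc⟩ : ∃ c, c = γ ^ 2 / p := ⟨_, rfl⟩
  have hc0 : 0 < c := by rw [hc]; positivity
  obtain ⟨B, hB⟩ : ∃ B, B = (2 * E + 2) ^ γ + (c * (2 * E + 2) + 1) / 2 := ⟨_, rfl⟩
  have hB0 : 0 < B := by rw [hB]; positivity
  refine ⟨B ^ 2, by positivity, fun S hE t ht a x hx => ?_⟩
  obtain ⟨Y, hY⟩ : ∃ Y, Y = ∫ y in a..(a + 1), S.diss p y t := ⟨_, rfl⟩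
  have hY0 : 0 ≤ Y := by
    rw [hY]
    exact intervalIntegral.integral_nonneg (by linarith) fun y _ => S.diss_nonneg hα hp.le y t
  obtain ⟨l, hl⟩ : ∃ l, l = Real.sqrt (1 + Y) := ⟨_, rfl⟩
  have hl2 : l ^ 2 = 1 + Y := by rw [hl, Real.sq_sqrt (by linarith)]
  have hl1 : 1 ≤ l := by rw [hl, Real.one_le_sqrt]; linarith
  have hl0 : 0 < l := by linarith
  obtain ⟨y₀, hy₀, hθy⟩ := exists_le_integral_unit (show Continuous fun y => S.θ y t by fun_prop) a
  have hθy' : S.θ y₀ t ^ γ ≤ (2 * E + 2) ^ γ :=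
    Real.rpow_le_rpow (S.θ_pos _ _).le (hθy.trans (hE.integral_θ_le ht a)) hγ0.le
  have h1 := le_add_integral_abs_deriv
    (fun y => (S.dx_θ y t).rpow_const (p := γ) (Or.inl (S.θ_ne y t))) (by fun_prop) hx hy₀
  have h2 := integral_mono_cont (a := a) (b := a + 1)
    (f := fun y => |S.θx y t * γ * S.θ y t ^ (γ - 1)|)
    (g := fun y => (l * c / 2) * S.v y t + (1 / (2 * l)) * S.diss p y t)
    (by fun_prop) (by fun_prop) (by linarith) fun y _ => by
      have hv := S.v_pos y t
      have hθ := S.θ_pos y t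
      have hD := S.diss_nonneg hα hp.le y t
      refine abs_le_of_sq_le_sq ?_ (by positivity)
      have e1 : (S.θ y t ^ (γ - 1)) ^ 2 = S.θ y t ^ (β - p - 1) := by
        rw [← Real.rpow_natCast, ← Real.rpow_mul hθ.le, hγ]
        congr 1
        push_cast
        ring
      have e2 : (S.θx y t * γ * S.θ y t ^ (γ - 1)) ^ 2
          = c * S.v y t * (p * S.θ y t ^ (β - p - 1) * S.θx y t ^ 2 / S.v y t) := by
        rw [mul_pow, mul_pow, e1, hc]
        field_simp
      have e3 : p * S.θ y t ^ (β - p - 1) * S.θx y t ^ 2 / S.v y t ≤ S.diss p y t := by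
        have : 0 ≤ S.θ y t ^ (-p) * S.heat y t :=
          mul_nonneg (by positivity) (S.heat_nonneg hα y t)
        unfold diss
        linarith
      have e4 : c * S.v y t * S.diss p y t
          = 4 * ((l * c / 2) * S.v y t) * ((1 / (2 * l)) * S.diss p y t) := by
        field_simp
        norm_num
      rw [e2]
      refine (mul_le_mul_of_nonneg_left e3 (by positivity)).trans ?_
      rw [e4]
      exact four_mul_le_sq_add _ _
  rw [intervalIntegral.integral_add (Continuous.intervalIntegrable (by fun_prop) _ _)
    (Continuous.intervalIntegrable (by fun_prop) _ _), intervalIntegral.integral_const_mul,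
    intervalIntegral.integral_const_mul, ← hY] at h2
  have h3 := mul_le_mul_of_nonneg_left (hE.integral_v_le ht a)
    (show 0 ≤ l * c / 2 by positivity)
  have h4 : 1 / (2 * l) * Y ≤ l / 2 := by
    rw [one_div_mul_eq_div, div_le_iff₀ (by positivity)]
    nlinarith
  have h5 : (2 * E + 2) ^ γ ≤ (2 * E + 2) ^ γ * l := le_mul_of_one_le_right (by positivity) hl1
  have h6 : S.θ x t ^ γ ≤ B * l := by
    rw [hB]
    linarith
  have e : S.θ x t ^ (β + 1 - p) = (S.θ x t ^ γ) ^ 2 := by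
    rw [← Real.rpow_natCast, ← Real.rpow_mul (S.θ_pos x t).le, hγ]
    congr 1
    push_cast
    ring
  rw [e, ← hY, ← hl2, ← mul_pow]
  exact pow_le_pow_left₀ (Real.rpow_nonneg (S.θ_pos x t).le _) h6 2

theorem cutoff_anti {R x y : ℝ} (hx : x ∈ Icc (-R) R) (hxy : |y| ≤ |x|) :
    cutoff R x ≤ cutoff R y := by
  have h1 := sq_div_sq_le_one hx
  have h2 : y ^ 2 / R ^ 2 ≤ x ^ 2 / R ^ 2 := by
    gcongr ?_ / _
    exact sq_le_sq.2 hxy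
  have h3 : 0 ≤ y ^ 2 / R ^ 2 := by positivity
  unfold cutoff
  exact pow_le_pow_left₀ (by linarith) (by linarith) 2

theorem exists_unit_interval {R x : ℝ} (hR : 2 ≤ R) (hx : x ∈ Icc (-R) R) :
    ∃ a, -R ≤ a ∧ a + 1 ≤ R ∧ x ∈ Icc a (a + 1) ∧
      ∀ y ∈ Icc a (a + 1), cutoff R x ≤ 2 * cutoff R y := by
  have hnear : |x| ≤ 1 → ∀ y, |y| ≤ 1 → cutoff R x ≤ 2 * cutoff R y := fun _ y hy => by
    have h1 := half_le_cutoff (R := R) (N := 1) (by linarith) (by linarith) (abs_le.1 hy)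
    have h2 := cutoff_le_one hx
    linarith
  have hfar : ∀ y, |y| ≤ |x| → cutoff R x ≤ 2 * cutoff R y := fun y hy => by
    linarith [cutoff_anti hx hy, cutoff_nonneg R y]
  rcases le_total 1 x with h | h
  · refine ⟨x - 1, by linarith, by linarith [hx.2], ⟨by linarith, by linarith⟩,
      fun y hy => hfar y ?_⟩
    rw [abs_of_nonneg (by linarith : 0 ≤ x), abs_of_nonneg (by linarith [hy.1])]
    linarith [hy.2]
  rcases le_total x (-1) with h' | h'
  · refine ⟨x, hx.1, by linarith, ⟨le_rfl, by linarith⟩, fun y hy => hfar y ?_⟩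
    rw [abs_of_nonpos (by linarith : x ≤ 0), abs_of_nonpos (by linarith [hy.2])]
    linarith [hy.1]
  have hxa : |x| ≤ 1 := abs_le.2 ⟨h', h⟩
  rcases le_total 0 x with h0 | h0
  · refine ⟨0, by linarith, by linarith, ⟨h0, by linarith⟩, fun y hy => hnear hxa y ?_⟩
    rw [abs_le]
    constructor <;> linarith [hy.1, hy.2]
  · refine ⟨-1, by linarith, by linarith, ⟨h', by linarith⟩, fun y hy => hnear hxa y ?_⟩
    rw [abs_le]
    constructor <;> linarith [hy.1, hy.2]

theorem exists_cutoff_θ_rpow_le (T K δ : ℝ) (hα : 0 ≤ α) {p : ℝ} (hp : 0 < p) (hpβ : p < β + 1)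
    {E : ℝ} (hE0 : 0 < E) :
    ∃ C > 0, ∀ S : MHDFlow α β T K δ, S.EnergyBound 1 E → ∀ t ∈ Icc 0 T, ∀ R ≥ 2,
      ∀ x ∈ Icc (-R) R, cutoff R x * S.θ x t ^ (β + 1 - p)
        ≤ C * (1 + ∫ y in (-R)..R, cutoff R y * S.diss p y t) := by
  obtain ⟨C, hC, h⟩ := exists_θ_rpow_le T K δ hα hp hpβ hE0
  refine ⟨2 * C, by positivity, fun S hE t ht R hR x hx => ?_⟩
  obtain ⟨a, ha, ha', hxa, hcut⟩ := exists_unit_interval hR hx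
  have h1 := mul_le_mul_of_nonneg_left (h S hE t ht a x hxa) (cutoff_nonneg R x)
  have h2 := integral_mono_cont (a := a) (b := a + 1)
    (f := fun y => cutoff R x * S.diss p y t) (g := fun y => 2 * (cutoff R y * S.diss p y t))
    (by fun_prop) (by fun_prop) (by linarith) fun y hy => by
      have := mul_le_mul_of_nonneg_right (hcut y hy) (S.diss_nonneg hα hp.le y t)
      linarith
  rw [intervalIntegral.integral_const_mul, intervalIntegral.integral_const_mul] at h2
  have h3 := integral_mono_interval_cont (f := fun y => cutoff R y * S.diss p y t) (by fun_prop)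
    (fun y => mul_nonneg (cutoff_nonneg R y) (S.diss_nonneg hα hp.le y t)) ha (by linarith) ha'
  have h4 := cutoff_le_one hx
  refine h1.trans ?_
  calc _ = C * (cutoff R x + cutoff R x * ∫ y in a..(a + 1), S.diss p y t) := by ring
    _ ≤ C * (2 * (1 + ∫ y in (-R)..R, cutoff R y * S.diss p y t)) := by
      refine mul_le_mul_of_nonneg_left ?_ hC.le
      linarith
    _ = _ := by ring

/-- If the remainder is absorbed, the dissipation is bounded. -/
theorem exists_dissBound_of_absorb (K : ℝ) (hα : 0 ≤ α) (hT : 0 < T) (hδ : 0 < δ) (hδ1 : δ ≤ 1)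
    {p : ℝ} (hp : 0 ≤ p) {E A : ℝ} (hA : 0 ≤ A)
    (h : ∀ S : MHDFlow α β T K δ, S.EnergyBound 1 E → ∀ R ≥ 2,
      ∫ s in (0:ℝ)..T, ∫ x in (-R)..R, cutoff R x * S.rem p x s
        ≤ A + 1 / 8 * ∫ s in (0:ℝ)..T, ∫ x in (-R)..R, cutoff R x * S.diss p x s) :
    ∃ C > 0, ∀ S : MHDFlow α β T K δ, S.EnergyBound 1 E → S.DissBound p C := by
  obtain ⟨C, hC, h0⟩ := exists_energy_initial_le α β T K hδ hδ1 hp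
  refine ⟨2 * (8 * (C + A + 1)), by positivity, fun S hE => S.dissBound_of_cutoff hα hT hp ?_⟩
  obtain ⟨R₀, hR₀⟩ := S.local_energy hα hT hp
  refine ⟨max R₀ 2, fun R hR => ?_⟩
  have hR2 : 2 ≤ R := (le_max_right _ _).trans hR
  have hR0 : 0 ≤ R := by linarith
  have h1 := hR₀ R ((le_max_left _ _).trans hR) T ⟨hT.le, le_rfl⟩
  have h2 := h S hE R hR2
  have h3 := S.integral_cutoff_energy_initial_le hp hR0
  have h4 := h0 S R hR0
  have h5 := integral_cutoff_nonneg (fun x => S.energy_nonneg hp x T) hR0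
  linarith

theorem DissBound.integral_cutoff_le {S : MHDFlow α β T K δ} (hα : 0 ≤ α) {p C : ℝ} (hp : 0 ≤ p)
    (h : S.DissBound p C) {R : ℝ} (hR : 0 ≤ R) {t : ℝ} (ht : t ∈ Icc 0 T) :
    ∫ s in (0:ℝ)..t, ∫ x in (-R)..R, cutoff R x * S.diss p x s ≤ C := by
  have hn : ∀ s, 0 ≤ ∫ x in (-R)..R, cutoff R x * S.diss p x s := fun s =>
    integral_cutoff_nonneg (fun x => S.diss_nonneg hα hp x s) hR
  have h1 := integral_mono_interval_cont (a := 0) (b := t) (c := 0) (d := T)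
    (f := fun s => ∫ x in (-R)..R, cutoff R x * S.diss p x s) (by fun_prop) hn le_rfl ht.1 ht.2
  refine h1.trans (le_trans ?_ (h R hR))
  refine integral_mono_cont (by fun_prop) (by fun_prop) (ht.1.trans ht.2) fun s _ => ?_
  exact integral_mono_cont (by fun_prop) (by fun_prop) (by linarith) fun x hx =>
    mul_le_of_le_one_left (S.diss_nonneg hα hp x s) (cutoff_le_one hx)

/-- Weighted control of the entropy by the dissipation at a fixed time. -/
theorem exists_integral_cutoff_relEnt_le (T K δ : ℝ) (hα : 0 ≤ α) {p q ε : ℝ} (hp : 0 < p)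
    (hpβ : p < β + 1) (hq : 0 ≤ q) (hqβ : q < β + 1 - p) (hε : 0 < ε) {E : ℝ} (hE0 : 0 < E) :
    ∃ A > 0, ∀ S : MHDFlow α β T K δ, S.EnergyBound 1 E → ∀ t ∈ Icc 0 T, ∀ R ≥ 2,
      ∫ x in (-R)..R, cutoff R x * ((1 + S.θ x t ^ q) * relEnt 1 (S.θ x t))
        ≤ A + ε * ∫ x in (-R)..R, cutoff R x * S.diss p x t := by
  obtain ⟨C, hC, h⟩ := exists_cutoff_θ_rpow_le T K δ hα hp hpβ hE0
  obtain ⟨M, hM, hpow⟩ := rpow_le_add_of_lt hq hqβ (show 0 < ε / (C * E) by positivity)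
  refine ⟨(1 + M) * E + ε, by positivity, fun S hE t ht R hR => ?_⟩
  obtain ⟨Y, hY⟩ : ∃ Y, Y = ∫ x in (-R)..R, cutoff R x * S.diss p x t := ⟨_, rfl⟩
  have hY0 : 0 ≤ Y := by
    rw [hY]
    exact integral_cutoff_nonneg (fun x => S.diss_nonneg hα hp.le x t) (by linarith)
  have h1 := integral_mono_cont (a := -R) (b := R)
    (f := fun x => cutoff R x * ((1 + S.θ x t ^ q) * relEnt 1 (S.θ x t)))
    (g := fun x => (1 + M + ε / E * (1 + Y)) * S.energy 1 x t) (by fun_prop) (by fun_prop)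
    (by linarith) fun x hx => by
      have e0 := relEnt_nonneg zero_le_one (S.θ_pos x t)
      have e1 := hpow _ (S.θ_pos x t)
      have e2 := h S hE t ht R hR x hx
      rw [← hY] at e2
      have e3 := cutoff_le_one hx
      have e4 := cutoff_nonneg R x
      have e5 : cutoff R x * (1 + S.θ x t ^ q) ≤ 1 + M + ε / E * (1 + Y) := by
        calc cutoff R x * (1 + S.θ x t ^ q)
            ≤ cutoff R x * (1 + (ε / (C * E) * S.θ x t ^ (β + 1 - p) + M)) := by gcongr
          _ = cutoff R x * (1 + M) + ε / (C * E) * (cutoff R x * S.θ x t ^ (β + 1 - p)) := by ring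
          _ ≤ 1 * (1 + M) + ε / (C * E) * (C * (1 + Y)) := by gcongr
          _ = _ := by field_simp
      rw [← mul_assoc]
      gcongr
      exact (S.components_le_energy x t).2.2.2
  rw [intervalIntegral.integral_const_mul] at h1
  have h2 := mul_le_mul_of_nonneg_left (hE t ht R (by linarith))
    (show 0 ≤ 1 + M + ε / E * (1 + Y) by positivity)
  rw [← hY]
  refine (h1.trans h2).trans_eq ?_
  field_simp
  ring

theorem exists_dissBound_of_lt_one (K : ℝ) (hα : 0 ≤ α) (hβ : 0 < β) (hT : 0 < T) (hδ : 0 < δ)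
    (hδ1 : δ ≤ 1) {p : ℝ} (hp : 0 < p) (hp1 : p < 1) {E : ℝ} (hE0 : 0 < E) :
    ∃ C > 0, ∀ S : MHDFlow α β T K δ, S.EnergyBound 1 E → S.DissBound p C := by
  obtain ⟨c, hc, hv⟩ := exists_le_v (T := T) β K hα hδ hE0
  obtain ⟨C₁, hC₁, hrem⟩ := remDens_le_of_lt_one hp.le hp1
  obtain ⟨A, hA, hint⟩ := exists_integral_cutoff_relEnt_le (β := β) T K δ hα hp (by linarith)
    (by linarith : 0 ≤ 1 - p) (by linarith) (show 0 < c / (8 * C₁) by positivity) hE0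
  refine exists_dissBound_of_absorb K hα hT hδ hδ1 hp.le (A := C₁ / c * A * T) (by positivity)
    fun S hE R hR => ?_
  have h1 := integral_mono_cont (a := 0) (b := T)
    (f := fun s => ∫ x in (-R)..R, cutoff R x * S.rem p x s)
    (g := fun s => C₁ / c * A + 1 / 8 * ∫ x in (-R)..R, cutoff R x * S.diss p x s)
    (by fun_prop) (by fun_prop) hT.le fun s hs => by
      have h2 := integral_mono_cont (a := -R) (b := R) (f := fun x => cutoff R x * S.rem p x s)
        (g := fun x => C₁ / c * (cutoff R x * ((1 + S.θ x s ^ (1 - p)) * relEnt 1 (S.θ x s))))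
        (by fun_prop) (by fun_prop) (by linarith) fun x _ => by
          have e0 := relEnt_nonneg zero_le_one (S.θ_pos x s)
          have e1 := S.θ_pos x s
          rw [← mul_assoc, mul_comm (C₁ / c), mul_assoc]
          refine mul_le_mul_of_nonneg_left ?_ (cutoff_nonneg R x)
          rw [rem, div_mul_eq_mul_div]
          exact div_le_div₀ (by positivity) (hrem _ (S.θ_pos x s)) hc (hv S hE s hs x)
      rw [intervalIntegral.integral_const_mul] at h2
      refine (h2.trans (mul_le_mul_of_nonneg_left (hint S hE s hs R hR)
        (by positivity))).trans_eq ?_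
      field_simp
  rw [intervalIntegral.integral_add (Continuous.intervalIntegrable (by fun_prop) _ _)
    (Continuous.intervalIntegrable (by fun_prop) _ _), intervalIntegral.integral_const,
    intervalIntegral.integral_const_mul, smul_eq_mul, sub_zero] at h1
  linarith

/-- Time-integrated control of the entropy weighted by a power of the temperature. -/
theorem exists_integral_integral_cutoff_relEnt_le (K : ℝ) (hα : 0 ≤ α) (hβ : 0 < β) (hT : 0 < T)
    (hδ : 0 < δ) (hδ1 : δ ≤ 1) {p q : ℝ} (hp : 0 < p) (hp1 : p < 1) (hq : 0 ≤ q)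
    (hqβ : q < β + 1 - p) {E : ℝ} (hE0 : 0 < E) :
    ∃ A > 0, ∀ S : MHDFlow α β T K δ, S.EnergyBound 1 E → ∀ t ∈ Icc 0 T, ∀ R ≥ 2,
      ∫ s in (0:ℝ)..t, ∫ x in (-R)..R, cutoff R x * ((1 + S.θ x s ^ q) * relEnt 1 (S.θ x s))
        ≤ A := by
  obtain ⟨C, hC, hD⟩ := exists_dissBound_of_lt_one K hα hβ hT hδ hδ1 hp hp1 hE0
  obtain ⟨A, hA, hint⟩ := exists_integral_cutoff_relEnt_le (β := β) T K δ hα hp (by linarith)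
    hq hqβ one_pos hE0
  refine ⟨A * T + C, by positivity, fun S hE t ht R hR => ?_⟩
  have h1 := integral_mono_cont (a := 0) (b := t)
    (f := fun s => ∫ x in (-R)..R, cutoff R x * ((1 + S.θ x s ^ q) * relEnt 1 (S.θ x s)))
    (g := fun s => A + 1 * ∫ x in (-R)..R, cutoff R x * S.diss p x s)
    (by fun_prop) (by fun_prop) ht.1 fun s hs => hint S hE s ⟨hs.1, hs.2.trans ht.2⟩ R hR
  rw [intervalIntegral.integral_add (Continuous.intervalIntegrable (by fun_prop) _ _)
    (Continuous.intervalIntegrable (by fun_prop) _ _), intervalIntegral.integral_const,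
    intervalIntegral.integral_const_mul, smul_eq_mul, sub_zero] at h1
  have h2 := (hD S hE).integral_cutoff_le hα hp.le (by linarith : 0 ≤ R) ht
  have h3 := mul_le_mul_of_nonneg_right ht.2 hA.le
  linarith

theorem exists_dissBound_zero (K : ℝ) (hα : 0 ≤ α) (hβ : 0 < β) (hT : 0 < T) (hδ : 0 < δ)
    (hδ1 : δ ≤ 1) {E : ℝ} (hE0 : 0 < E) :
    ∃ C > 0, ∀ S : MHDFlow α β T K δ, S.EnergyBound 1 E → S.DissBound 0 C := by
  have hp : 0 < min β 1 / 2 := by positivity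
  have hp1 : min β 1 / 2 < 1 := by linarith [min_le_right β 1]
  obtain ⟨c, hc, hv⟩ := exists_le_v (T := T) β K hα hδ hE0
  obtain ⟨C₁, hC₁, hrem⟩ := remDens_le_of_lt_one le_rfl zero_lt_one
  obtain ⟨A, hA, hint⟩ := exists_integral_integral_cutoff_relEnt_le K hα hβ hT hδ hδ1 hp hp1
    (by norm_num : (0:ℝ) ≤ 1 - 0) (by linarith [min_le_left β 1]) hE0
  refine exists_dissBound_of_absorb K hα hT hδ hδ1 le_rfl (A := C₁ / c * A) (by positivity)
    fun S hE R hR => ?_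
  have h1 := integral_mono_cont (a := 0) (b := T)
    (f := fun s => ∫ x in (-R)..R, cutoff R x * S.rem 0 x s)
    (g := fun s => C₁ / c * ∫ x in (-R)..R, cutoff R x
      * ((1 + S.θ x s ^ (1 - 0 : ℝ)) * relEnt 1 (S.θ x s)))
    (by fun_prop) (by fun_prop) hT.le fun s hs => by
      rw [← intervalIntegral.integral_const_mul]
      refine integral_mono_cont (by fun_prop) (by fun_prop) (by linarith) fun x _ => ?_
      have e0 := relEnt_nonneg zero_le_one (S.θ_pos x s)
      have e1 := S.θ_pos x s
      rw [← mul_assoc, mul_comm (C₁ / c), mul_assoc]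
      refine mul_le_mul_of_nonneg_left ?_ (cutoff_nonneg R x)
      rw [rem, div_mul_eq_mul_div]
      exact div_le_div₀ (by positivity) (hrem _ (S.θ_pos x s)) hc (hv S hE s hs x)
  rw [intervalIntegral.integral_const_mul] at h1
  have h2 := mul_le_mul_of_nonneg_left (hint S hE T ⟨hT.le, le_rfl⟩ R hR)
    (show 0 ≤ C₁ / c by positivity)
  have h3 : 0 ≤ ∫ s in (0:ℝ)..T, ∫ x in (-R)..R, cutoff R x * S.diss 0 x s :=
    intervalIntegral.integral_nonneg hT.le fun s _ =>
      integral_cutoff_nonneg (fun x => S.diss_nonneg hα le_rfl x s) (by linarith)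
  linarith

theorem exists_dissBound_of_one_lt (K : ℝ) (hα : 0 ≤ α) (hβ : 1 < β) (hT : 0 < T) (hδ : 0 < δ)
    (hδ1 : δ ≤ 1) {E : ℝ} (hE0 : 0 < E) :
    ∃ C > 0, ∀ S : MHDFlow α β T K δ, S.EnergyBound 1 E → S.DissBound β C := by
  have hβ0 : 0 ≤ β := by linarith
  obtain ⟨c, hc, hv⟩ := exists_le_v (T := T) β K hα hδ hE0
  obtain ⟨C₁, hC₁, hrem⟩ := remDens_le_of_one_lt hβ
  obtain ⟨A, hA, hint⟩ := exists_integral_integral_cutoff_relEnt_le (β := β) K hα (by linarith) hT hδ hδ1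
    one_half_pos one_half_lt_one (by linarith : 0 ≤ β - 1) (by linarith) hE0
  obtain ⟨C₀, hC₀, h0⟩ := exists_energy_initial_le α β T K hδ hδ1 hβ0
  obtain ⟨B, hB⟩ : ∃ B, B = C₀ + C₁ / c * A + 1 := ⟨_, rfl⟩
  have hB0 : 0 < B := by rw [hB]; positivity
  obtain ⟨D, hD⟩ : ∃ D, D = C₁ / c := ⟨_, rfl⟩
  have hD0 : 0 < D := by rw [hD]; positivity
  refine ⟨2 * (4 * (B + D * (T * (B * Real.exp (D * T))))), by positivity,
    fun S hE => S.dissBound_of_cutoff hα hT hβ0 ?_⟩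
  obtain ⟨R₀, hR₀⟩ := S.local_energy hα hT hβ0
  refine ⟨max R₀ 2, fun R hR => ?_⟩
  have hR2 : 2 ≤ R := (le_max_right _ _).trans hR
  have hbase : ∀ t ∈ Icc 0 T, (∫ x in (-R)..R, cutoff R x * S.energy β x t)
      + 1 / 4 * (∫ s in (0:ℝ)..t, ∫ x in (-R)..R, cutoff R x * S.diss β x s)
      ≤ B + D * ∫ s in (0:ℝ)..t, ∫ x in (-R)..R, cutoff R x * S.energy β x s := fun t ht => by
    have h1 := hR₀ R ((le_max_left _ _).trans hR) t ht
    have h2 := S.integral_cutoff_energy_initial_le hβ0 (by linarith : 0 ≤ R)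
    have h3 := h0 S R (by linarith)
    have h4 := integral_mono_cont (a := 0) (b := t)
      (f := fun s => ∫ x in (-R)..R, cutoff R x * S.rem β x s)
      (g := fun s => D * (∫ x in (-R)..R, cutoff R x
          * ((1 + S.θ x s ^ (β - 1)) * relEnt 1 (S.θ x s)))
        + D * ∫ x in (-R)..R, cutoff R x * S.energy β x s)
      (by fun_prop) (by fun_prop) ht.1 fun s hs => by
        rw [← intervalIntegral.integral_const_mul, ← intervalIntegral.integral_const_mul,
          ← intervalIntegral.integral_add (Continuous.intervalIntegrable (by fun_prop) _ _)
            (Continuous.intervalIntegrable (by fun_prop) _ _)]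
        refine integral_mono_cont (by fun_prop) (by fun_prop) (by linarith) fun x _ => ?_
        have e0 := relEnt_nonneg zero_le_one (S.θ_pos x s)
        have e0' := relEnt_nonneg hβ0 (S.θ_pos x s)
        have e1 := S.θ_pos x s
        have e2 : relEnt β (S.θ x s) ≤ S.energy β x s := by
          have := S.v_pos x s
          have := relEnt_nonneg zero_le_one (S.v_pos x s)
          unfold energy
          have : 0 ≤ S.u x s ^ 2 / 2 + (S.w₁ x s ^ 2 + S.w₂ x s ^ 2) / 2
            + S.v x s * (S.b₁ x s ^ 2 + S.b₂ x s ^ 2) / 2 := by positivity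
          linarith
        have e3 : S.rem β x s ≤ D * ((1 + S.θ x s ^ (β - 1)) * relEnt 1 (S.θ x s))
            + D * S.energy β x s := by
          calc S.rem β x s
              ≤ (C₁ * ((1 + S.θ x s ^ (β - 1)) * relEnt 1 (S.θ x s))
                  + C₁ * relEnt β (S.θ x s)) / c := by
                rw [rem]
                exact div_le_div₀ (by positivity) (hrem _ (S.θ_pos x s)) hc
                  (hv S hE s ⟨hs.1, hs.2.trans ht.2⟩ x)
            _ = D * ((1 + S.θ x s ^ (β - 1)) * relEnt 1 (S.θ x s))
                  + D * relEnt β (S.θ x s) := by rw [hD]; ring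
            _ ≤ _ := by gcongr
        refine (mul_le_mul_of_nonneg_left e3 (cutoff_nonneg R x)).trans_eq ?_
        ring
    rw [intervalIntegral.integral_add (Continuous.intervalIntegrable (by fun_prop) _ _)
      (Continuous.intervalIntegrable (by fun_prop) _ _), intervalIntegral.integral_const_mul,
      intervalIntegral.integral_const_mul] at h4
    have h5 := mul_le_mul_of_nonneg_left (hint S hE t ht R hR2) hD0.le
    rw [← hD] at hB
    linarith
  have hG : ∀ t ∈ Icc 0 T, ∫ x in (-R)..R, cutoff R x * S.energy β x t
      ≤ B * Real.exp (D * T) := fun t ht => by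
    have h1 := gronwall_integral (f := fun t => ∫ x in (-R)..R, cutoff R x * S.energy β x t)
      (by fun_prop) (A := B) hD0.le (fun t ht => by
        have h2 : 0 ≤ ∫ s in (0:ℝ)..t, ∫ x in (-R)..R, cutoff R x * S.diss β x s :=
          intervalIntegral.integral_nonneg ht.1 fun s _ =>
            integral_cutoff_nonneg (fun x => S.diss_nonneg hα hβ0 x s) (by linarith)
        have h3 := hbase t ht
        linarith) ht
    refine h1.trans ?_
    gcongr
    exact ht.2
  have h1 := hbase T ⟨hT.le, le_rfl⟩
  have h2 := integral_cutoff_nonneg (R := R) (fun x => S.energy_nonneg hβ0 x T) (by linarith)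
  have h3 := integral_mono_cont (a := 0) (b := T)
    (f := fun t => ∫ x in (-R)..R, cutoff R x * S.energy β x t)
    (g := fun _ => B * Real.exp (D * T)) (by fun_prop) (by fun_prop) hT.le hG
  rw [intervalIntegral.integral_const, smul_eq_mul, sub_zero] at h3
  have h4 := mul_le_mul_of_nonneg_left h3 hD0.le
  linarith

theorem DissBound.integral_unit_le {S : MHDFlow α β T K δ} {p C : ℝ} (hD : S.DissBound p C)
    (hα : 0 ≤ α) (hp : 0 ≤ p) {t : ℝ} (ht : t ∈ Icc 0 T) (a : ℝ) :
    ∫ s in (0:ℝ)..t, ∫ x in a..(a + 1), S.diss p x s ≤ C := by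
  have ha := neg_abs_le a
  have ha' := le_abs_self a
  have h0 : ∀ N ≥ 0, ∀ s, 0 ≤ ∫ x in (-N)..N, S.diss p x s := fun N hN s =>
    intervalIntegral.integral_nonneg (by linarith) fun x _ => S.diss_nonneg hα hp x s
  have h1 := integral_mono_cont (a := 0) (b := t)
    (f := fun s => ∫ x in a..(a + 1), S.diss p x s)
    (g := fun s => ∫ x in (-(|a| + 1))..(|a| + 1), S.diss p x s) (by fun_prop) (by fun_prop) ht.1
    fun s _ => integral_mono_interval_cont (by fun_prop) (fun x => S.diss_nonneg hα hp x s)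
      (by linarith) (by linarith) (by linarith)
  refine (h1.trans ?_).trans (hD (|a| + 1) (by positivity))
  exact integral_mono_interval_cont (by fun_prop) (h0 _ (by positivity)) le_rfl ht.1 ht.2

theorem diss_zero (S : MHDFlow α β T K δ) (x t : ℝ) : S.diss 0 x t = S.heat x t := by
  simp [diss]

/-- Pointwise bound of the magnetic energy by the local dissipation. -/
theorem EnergyBound.magnetic_le {S : MHDFlow α β T K δ} {E c : ℝ} (hE : S.EnergyBound 1 E)
    (hα : 0 ≤ α) (hc : 0 < c) {t : ℝ} (ht : t ∈ Icc 0 T) (hv : ∀ x, c ≤ S.v x t) {a x : ℝ}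
    (hx : x ∈ Icc a (a + 1)) :
    S.b₁ x t ^ 2 + S.b₂ x t ^ 2 ≤ 2 * E / c + 2 * E + ∫ y in a..(a + 1), S.diss 0 y t := by
  have hm := hE.integral_magnetic_le ht a
  obtain ⟨y, hy, hgy⟩ := exists_le_integral_unit
    (show Continuous fun y => S.b₁ y t ^ 2 + S.b₂ y t ^ 2 by fun_prop) a
  have h1 := le_add_integral_abs_deriv
    (fun y => ((S.dx_b₁ y t).fun_pow 2).fun_add ((S.dx_b₂ y t).fun_pow 2)) (by fun_prop) hx hy
  have h2 := integral_mono_cont (a := a) (b := a + 1)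
    (f := fun y => S.b₁ y t ^ 2 + S.b₂ y t ^ 2)
    (g := fun y => 1 / c * (S.v y t * (S.b₁ y t ^ 2 + S.b₂ y t ^ 2)))
    (by fun_prop) (by fun_prop) (by linarith) fun y _ => by
      rw [← mul_assoc]
      refine le_mul_of_one_le_left (by positivity) ?_
      rw [one_div_mul_eq_div, one_le_div hc]
      exact hv y
  have h3 := integral_mono_cont (a := a) (b := a + 1)
    (f := fun y => |((2 : ℕ) : ℝ) * S.b₁ y t ^ (2 - 1) * S.b₁x y t
      + ((2 : ℕ) : ℝ) * S.b₂ y t ^ (2 - 1) * S.b₂x y t|)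
    (g := fun y => S.v y t * (S.b₁ y t ^ 2 + S.b₂ y t ^ 2) + S.diss 0 y t)
    (by fun_prop) (by fun_prop) (by linarith) fun y _ => by
      have hvy := S.v_pos y t
      have hmu := S.one_le_visc hα y t
      have h : (S.b₁x y t ^ 2 + S.b₂x y t ^ 2) / S.v y t ≤ S.diss 0 y t := by
        rw [diss_zero, heat]
        exact div_le_div_of_nonneg_right (le_add_of_nonneg_left (by positivity)) hvy.le
      refine le_trans ?_ (add_le_add_right h _)
      have e : S.v y t * (S.b₁ y t ^ 2 + S.b₂ y t ^ 2)
          + (S.b₁x y t ^ 2 + S.b₂x y t ^ 2) / S.v y t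
          - |2 * S.b₁ y t * S.b₁x y t + 2 * S.b₂ y t * S.b₂x y t| ≥ 0 := by
        rcases abs_cases (2 * S.b₁ y t * S.b₁x y t + 2 * S.b₂ y t * S.b₂x y t) with h | h <;>
          rw [h.1]
        · have : 0 ≤ ((S.v y t * S.b₁ y t - S.b₁x y t) ^ 2
            + (S.v y t * S.b₂ y t - S.b₂x y t) ^ 2) / S.v y t := by positivity
          refine this.trans_eq ?_
          field_simp
          ring
        · have : 0 ≤ ((S.v y t * S.b₁ y t + S.b₁x y t) ^ 2
            + (S.v y t * S.b₂ y t + S.b₂x y t) ^ 2) / S.v y t := by positivity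
          refine this.trans_eq ?_
          field_simp
          ring
      norm_num
      linarith
  rw [intervalIntegral.integral_const_mul] at h2
  rw [intervalIntegral.integral_add (Continuous.intervalIntegrable (by fun_prop) _ _)
    (Continuous.intervalIntegrable (by fun_prop) _ _)] at h3
  have h4 := mul_le_mul_of_nonneg_left hm (show 0 ≤ 1 / c by positivity)
  have h5 : 1 / c * (2 * E + 0) = 2 * E / c := by ring
  linarith

/-- Uniform bound for the accumulated pressure. -/
theorem exists_accPres_le (K : ℝ) (hα : 0 ≤ α) (hβ : 0 < β) (hT : 0 < T) (hδ : 0 < δ)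
    (hδ1 : δ ≤ 1) {E : ℝ} (hE0 : 0 < E) :
    ∃ B > 0, ∀ S : MHDFlow α β T K δ, S.EnergyBound 1 E → ∀ t ∈ Icc 0 T, ∀ x,
      S.accPres x t ≤ B := by
  have hp : 0 < min β 1 / 2 := by positivity
  have hpβ := min_le_left β 1
  have hp1 := min_le_right β 1
  obtain ⟨p, hp'⟩ : ∃ p, p = min β 1 / 2 := ⟨_, rfl⟩
  rw [← hp'] at hp
  obtain ⟨c, hc, hv⟩ := exists_le_v (T := T) β K hα hδ hE0
  obtain ⟨C₀, hC₀, hD₀⟩ := exists_dissBound_zero K hα hβ hT hδ hδ1 hE0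
  obtain ⟨C₁, hC₁, hD₁⟩ := exists_dissBound_of_lt_one K hα hβ hT hδ hδ1 hp (by linarith) hE0
  obtain ⟨C₂, hC₂, hθ⟩ := exists_θ_rpow_le (β := β) T K δ hα hp (by linarith) hE0
  obtain ⟨M, hM⟩ : ∃ M, M = 1 / c * (1 + C₂) + (E / c + E) := ⟨_, rfl⟩
  have hM0 : 0 < M := by rw [hM]; positivity
  refine ⟨M * T + 1 / c * C₂ * C₁ + 1 / 2 * C₀, by positivity,
    fun S hE t ht x => ?_⟩
  have hx : x ∈ Icc x (x + 1) := ⟨le_rfl, by linarith⟩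
  have h1 := integral_mono_cont (a := 0) (b := t) (f := fun s => S.pres x s)
    (g := fun s => M
      + (1 / c * C₂ * (∫ y in x..(x + 1), S.diss p y s)
        + 1 / 2 * ∫ y in x..(x + 1), S.diss 0 y s)) (by fun_prop) (by fun_prop) ht.1
    fun s hs => by
      have hs' : s ∈ Icc 0 T := ⟨hs.1, hs.2.trans ht.2⟩
      have hθp := S.θ_pos x s
      have e1 := hE.magnetic_le hα hc hs' (hv S hE s hs') hx
      have e2 := hθ S hE s hs' x x hx
      have e3 : S.θ x s ≤ 1 + S.θ x s ^ (β + 1 - p) := by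
        simpa using rpow_le_one_add zero_le_one (by linarith : 1 ≤ β + 1 - p) hθp
      have e4 : S.θ x s / S.v x s
          ≤ (1 + C₂ * (1 + ∫ y in x..(x + 1), S.diss p y s)) / c :=
        div_le_div₀ (by have := Real.rpow_nonneg hθp.le (β + 1 - p); linarith) (by linarith) hc
          (hv S hE s hs' x)
      rw [pres]
      refine (add_le_add e4 (div_le_div_of_nonneg_right e1 zero_le_two)).trans_eq ?_
      rw [hM]
      ring
  rw [intervalIntegral.integral_add (Continuous.intervalIntegrable (by fun_prop) _ _)
    (Continuous.intervalIntegrable (by fun_prop) _ _), intervalIntegral.integral_add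
    (Continuous.intervalIntegrable (by fun_prop) _ _)
    (Continuous.intervalIntegrable (by fun_prop) _ _), intervalIntegral.integral_const,
    intervalIntegral.integral_const_mul, intervalIntegral.integral_const_mul, smul_eq_mul,
    sub_zero] at h1
  have h2 := mul_le_mul_of_nonneg_left ((hD₁ S hE).integral_unit_le hα hp.le ht x)
    (show 0 ≤ 1 / c * C₂ by positivity)
  have h3 := (hD₀ S hE).integral_unit_le hα le_rfl ht x
  have h4 := mul_le_mul_of_nonneg_right ht.2 hM0.le
  rw [accPres]
  linarith

/-- Uniform upper bound for the specific volume. -/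
theorem exists_v_le (K : ℝ) (hα : 0 ≤ α) (hβ : 0 < β) (hT : 0 < T) (hδ : 0 < δ)
    (hδ1 : δ ≤ 1) {E : ℝ} (hE0 : 0 < E) :
    ∃ V > 0, ∀ S : MHDFlow α β T K δ, S.EnergyBound 1 E → ∀ t ∈ Icc 0 T, ∀ x, S.v x t ≤ V := by
  obtain ⟨B, hB, hacc⟩ := exists_accPres_le K hα hβ hT hδ hδ1 hE0
  refine ⟨Real.exp (Real.log (K ^ 2 + 2) + B + (Real.log (2 * E + 2) - viscPot α δ + (2 * E + 1))
    + 1) + 1, by positivity, fun S hE t ht x => ?_⟩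
  have hx : x ∈ Icc x (x + 1) := ⟨le_rfl, by linarith⟩
  obtain ⟨z, hz, hvz⟩ := exists_le_integral_unit (show Continuous fun y => S.v y t by fun_prop) x
  have h1 := hE.effPot_le ht hx hz
  have h2 := (viscPot_le_log α (S.v_pos z t)).trans
    (Real.log_le_log (S.v_pos z t) (hvz.trans (hE.integral_v_le ht x)))
  have h3 := viscPot_mono hα hδ (S.v_initial z)
  have h4 := (viscPot_le_log α (S.v_pos x 0)).trans
    (Real.log_le_log (S.v_pos x 0) (S.v_initial_le x))
  have h5 := hacc S hE t ht x
  have h6 := S.accPres_nonneg z ht.1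
  rcases le_total (S.v x t) 1 with h | h
  · exact h.trans (le_add_of_nonneg_left (Real.exp_pos _).le)
  · have h7 : S.v x t ^ (-α) ≤ 1 := Real.rpow_le_one_of_one_le_of_nonpos h (by linarith)
    refine le_trans ?_ (le_add_of_nonneg_right zero_le_one)
    rw [← Real.log_le_iff_le_exp (S.v_pos x t)]
    simp only [effPot] at h1
    have h8 : Real.log (S.v x t) = viscPot α (S.v x t) + S.v x t ^ (-α) := by
      rw [viscPot]; ring
    linarith

theorem ux_sq_le (S : MHDFlow α β T K δ) (hα : 0 ≤ α) {V x t : ℝ} (hv : S.v x t ≤ V) :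
    S.ux x t ^ 2 ≤ V * S.diss 0 x t := by
  have h0 := S.v_pos x t
  have hmu := S.one_le_visc hα x t
  have h1 : S.ux x t ^ 2 / S.v x t ≤ S.diss 0 x t := by
    rw [diss_zero, heat, add_assoc]
    refine div_le_div_of_nonneg_right ?_ h0.le
    exact (le_mul_of_one_le_left (by positivity) hmu).trans
      (le_add_of_nonneg_right (by positivity))
  rw [div_le_iff₀ h0] at h1
  have := mul_le_mul_of_nonneg_left hv (S.diss_nonneg hα le_rfl x t)
  linarith

theorem rpow_mul_θx_sq_le (S : MHDFlow α β T K δ) (hα : 0 ≤ α) {p : ℝ} (hp : 0 < p) {V x t : ℝ}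
    (hv : S.v x t ≤ V) :
    S.θ x t ^ (β - p - 1) * S.θx x t ^ 2 ≤ V / p * S.diss p x t := by
  have h0 := S.v_pos x t
  have h1 : p * S.θ x t ^ (β - p - 1) * S.θx x t ^ 2 / S.v x t ≤ S.diss p x t :=
    le_add_of_nonneg_left
      (mul_nonneg (Real.rpow_nonneg (S.θ_pos x t).le _) (S.heat_nonneg hα x t))
  rw [div_le_iff₀ h0] at h1
  have := mul_le_mul_of_nonneg_left hv (S.diss_nonneg hα hp.le x t)
  rw [div_mul_eq_mul_div, le_div_iff₀ hp]
  linarith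

/-- Space-time bound of `θ⁻¹ θx²` by the dissipation. -/
theorem exists_integral_θx_sq_le (K : ℝ) (hα : 0 ≤ α) (hβ : 0 < β) (hT : 0 < T) (hδ : 0 < δ)
    (hδ1 : δ ≤ 1) {E : ℝ} (hE0 : 0 < E) :
    ∃ C > 0, ∀ S : MHDFlow α β T K δ, S.EnergyBound 1 E → S.DissBound 1 E → ∀ N ≥ 0,
      ∫ s in (0:ℝ)..T, ∫ x in (-N)..N, (S.θ x s)⁻¹ * S.θx x s ^ 2 ≤ C := by
  obtain ⟨V, hV, hv⟩ := exists_v_le K hα hβ hT hδ hδ1 hE0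
  rcases lt_or_ge 1 β with hβ1 | hβ1
  · obtain ⟨C, hC, hD⟩ := exists_dissBound_of_one_lt K hα hβ1 hT hδ hδ1 hE0
    refine ⟨V / β * C, by positivity, fun S hE _ N hN => ?_⟩
    have h1 := integral_mono_cont (a := 0) (b := T)
      (f := fun s => ∫ x in (-N)..N, (S.θ x s)⁻¹ * S.θx x s ^ 2)
      (g := fun s => V / β * ∫ x in (-N)..N, S.diss β x s)
      (by fun_prop (disch := intros; simp)) (by fun_prop) hT.le fun s hs => by
        rw [← intervalIntegral.integral_const_mul]
        refine integral_mono_cont (by fun_prop (disch := intros; simp)) (by fun_prop)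
          (by linarith) fun x _ => ?_
        have := S.rpow_mul_θx_sq_le hα hβ (hv S hE s hs x)
        rwa [sub_self, zero_sub, Real.rpow_neg_one] at this
    rw [intervalIntegral.integral_const_mul] at h1
    exact h1.trans (mul_le_mul_of_nonneg_left (hD S hE N hN) (by positivity))
  · obtain ⟨p, hp'⟩ : ∃ p, p = β / 2 := ⟨_, rfl⟩
    have hp : 0 < p := by rw [hp']; positivity
    obtain ⟨C, hC, hD⟩ := exists_dissBound_of_lt_one K hα hβ hT hδ hδ1 hp (by linarith) hE0
    refine ⟨V / 1 * E + V / p * C, by positivity, fun S hE hE' N hN => ?_⟩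
    have h1 := integral_mono_cont (a := 0) (b := T)
      (f := fun s => ∫ x in (-N)..N, (S.θ x s)⁻¹ * S.θx x s ^ 2)
      (g := fun s => V / 1 * (∫ x in (-N)..N, S.diss 1 x s)
        + V / p * ∫ x in (-N)..N, S.diss p x s)
      (by fun_prop (disch := intros; simp)) (by fun_prop) hT.le fun s hs => by
        rw [← intervalIntegral.integral_const_mul, ← intervalIntegral.integral_const_mul,
          ← intervalIntegral.integral_add (Continuous.intervalIntegrable (by fun_prop) _ _)
            (Continuous.intervalIntegrable (by fun_prop) _ _)]
        refine integral_mono_cont (by fun_prop (disch := intros; simp)) (by fun_prop)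
          (by linarith) fun x _ => ?_
        have hθ := S.θ_pos x s
        refine le_trans ?_ (add_le_add
          (S.rpow_mul_θx_sq_le hα one_pos (hv S hE s hs x))
          (S.rpow_mul_θx_sq_le hα hp (hv S hE s hs x)))
        rw [← add_mul, ← Real.rpow_neg_one]
        refine mul_le_mul_of_nonneg_right ?_ (sq_nonneg _)
        rcases le_total (S.θ x s) 1 with h | h
        · exact (Real.rpow_le_rpow_of_exponent_ge hθ h (by linarith)).trans
            (le_add_of_nonneg_right (by positivity))
        · exact (Real.rpow_le_rpow_of_exponent_le h (by linarith)).trans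
            (le_add_of_nonneg_left (by positivity))
    rw [intervalIntegral.integral_add (Continuous.intervalIntegrable (by fun_prop) _ _)
      (Continuous.intervalIntegrable (by fun_prop) _ _), intervalIntegral.integral_const_mul,
      intervalIntegral.integral_const_mul] at h1
    exact h1.trans (add_le_add (mul_le_mul_of_nonneg_left (hE' N hN) (by positivity))
      (mul_le_mul_of_nonneg_left (hD S hE N hN) (by positivity)))

/-- Space-time bound of the velocity and temperature gradients on bounded intervals. -/
theorem exists_integral_gradient_le (α β T K δ : ℝ) (hα : 0 ≤ α) (hβ : 0 < β) (hT : 0 < T)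
    (hδ : 0 < δ) (hδ1 : δ ≤ 1) :
    ∃ C > 0, ∀ S : MHDFlow α β T K δ, ∀ N ≥ 0,
      ∫ s in (0:ℝ)..T, ∫ x in (-N)..N, (S.ux x s ^ 2 + (S.θ x s)⁻¹ * S.θx x s ^ 2) ≤ C := by
  obtain ⟨E, hE0, hE⟩ := exists_entropy_bound (α := α) (β := β) K hα hT hδ hδ1
  obtain ⟨V, hV, hv⟩ := exists_v_le (β := β) K hα hβ hT hδ hδ1 hE0
  obtain ⟨C₀, hC₀, hD⟩ := exists_dissBound_zero (β := β) K hα hβ hT hδ hδ1 hE0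
  obtain ⟨C₁, hC₁, hθ⟩ := exists_integral_θx_sq_le (β := β) K hα hβ hT hδ hδ1 hE0
  refine ⟨V * C₀ + C₁, by positivity, fun S N hN => ?_⟩
  have h1 := integral_mono_cont (a := 0) (b := T)
    (f := fun s => ∫ x in (-N)..N, (S.ux x s ^ 2 + (S.θ x s)⁻¹ * S.θx x s ^ 2))
    (g := fun s => V * (∫ x in (-N)..N, S.diss 0 x s)
      + ∫ x in (-N)..N, (S.θ x s)⁻¹ * S.θx x s ^ 2)
    (by fun_prop (disch := intros; simp)) (by fun_prop (disch := intros; simp)) hT.le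
    fun s hs => by
      rw [← intervalIntegral.integral_const_mul, ← intervalIntegral.integral_add
        (Continuous.intervalIntegrable (by fun_prop) _ _)
        (Continuous.intervalIntegrable (by fun_prop (disch := intros; simp)) _ _)]
      exact integral_mono_cont (by fun_prop (disch := intros; simp))
        (by fun_prop (disch := intros; simp)) (by linarith)
        fun x _ => add_le_add_left (S.ux_sq_le hα (hv S (hE S).1 s hs x)) _
  rw [intervalIntegral.integral_add (Continuous.intervalIntegrable (by fun_prop) _ _)
    (Continuous.intervalIntegrable (by fun_prop (disch := intros; simp)) _ _),
    intervalIntegral.integral_const_mul] at h1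
  exact h1.trans (add_le_add (mul_le_mul_of_nonneg_left (hD S (hE S).1 N hN) hV.le)
    (hθ S (hE S).1 (hE S).2 N hN))

end MHDFlow

/-- Monotone convergence: a bound over all symmetric intervals passes to the whole line. -/
theorem integral_integral_line_le {f : ℝ → ℝ → ℝ} (hf : Continuous fun p : ℝ × ℝ => f p.1 p.2)
    (h0 : ∀ x t, 0 ≤ f x t) {T C : ℝ} (hT : 0 ≤ T)
    (h : ∀ N ≥ 0, ∫ t in (0:ℝ)..T, ∫ x in (-N)..N, f x t ≤ C) :
    ∫ t in (0:ℝ)..T, ∫ x, f x t ≤ C := by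
  have hft : ∀ t, Continuous fun x => f x t := fun t => hf.comp (continuous_id.prodMk continuous_const)
  have hC : 0 ≤ C := (intervalIntegral.integral_nonneg hT fun t _ => by simp).trans (h 0 le_rfl)
  have hmeas : Measurable fun p : ℝ × ℝ => ENNReal.ofReal (f p.2 p.1) :=
    (hf.comp continuous_swap).measurable.ennreal_ofReal
  have hfin : ∀ n : ℕ, ∫⁻ t in Ioc 0 T, ∫⁻ x in Ioc (-(n:ℝ)) n, ENNReal.ofReal (f x t)
      ≤ ENNReal.ofReal C := fun n => by
    have hn : -(n:ℝ) ≤ n := by linarith [(n.cast_nonneg : (0:ℝ) ≤ n)]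
    have hcont : Continuous fun t => ∫ x in (-(n:ℝ))..n, f x t := by
      refine intervalIntegral.continuous_parametric_intervalIntegral_of_continuous' ?_ _ _
      exact hf.comp continuous_swap
    have h1 : ∀ t, ∫⁻ x in Ioc (-(n:ℝ)) n, ENNReal.ofReal (f x t)
        = ENNReal.ofReal (∫ x in (-(n:ℝ))..n, f x t) := fun t => by
      rw [intervalIntegral.integral_of_le hn, ofReal_integral_eq_lintegral_ofReal
        (((hft t).intervalIntegrable _ _).1) (ae_of_all _ fun x => h0 x t)]
    simp_rw [h1]
    rw [← ofReal_integral_eq_lintegral_ofReal (hcont.intervalIntegrable _ _).1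
      (ae_of_all _ fun t => intervalIntegral.integral_nonneg hn fun x _ => h0 x t),
      ← intervalIntegral.integral_of_le hT]
    exact ENNReal.ofReal_le_ofReal (h n n.cast_nonneg)
  have hmono : Monotone fun n : ℕ => Ioc (-(n:ℝ)) n := fun m n hmn =>
    Ioc_subset_Ioc (neg_le_neg (Nat.cast_le.2 hmn)) (Nat.cast_le.2 hmn)
  have hunion : (⋃ n : ℕ, Ioc (-(n:ℝ)) n) = univ := by
    refine eq_univ_of_forall fun x => mem_iUnion.2 ?_
    obtain ⟨n, hn⟩ := exists_nat_gt |x|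
    exact ⟨n, by linarith [neg_abs_le x], by linarith [le_abs_self x]⟩
  have hline : ∀ t, ∫⁻ x, ENNReal.ofReal (f x t)
      = ⨆ n : ℕ, ∫⁻ x in Ioc (-(n:ℝ)) n, ENNReal.ofReal (f x t) := fun t => by
    rw [← setLIntegral_iUnion_of_directed _ hmono.directed_le, hunion, setLIntegral_univ]
  have htotal : ∫⁻ t in Ioc 0 T, ∫⁻ x, ENNReal.ofReal (f x t) ≤ ENNReal.ofReal C := by
    simp_rw [hline]
    rw [lintegral_iSup (fun n => Measurable.lintegral_prod_right' hmeas)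
      fun m n hmn t => lintegral_mono_set (hmono hmn)]
    exact iSup_le hfin
  have hG : AEStronglyMeasurable (fun t => ∫ x, f x t) (volume.restrict (Ioc 0 T)) :=
    ((hf.comp continuous_swap).stronglyMeasurable.integral_prod_right
      (f := fun t x => f x t)).aestronglyMeasurable
  rw [intervalIntegral.integral_of_le hT, integral_eq_lintegral_of_nonneg_ae
    (ae_of_all _ fun t => integral_nonneg fun x => h0 x t) hG]
  refine ENNReal.toReal_le_of_le_ofReal hC (le_trans (lintegral_mono fun t => ?_) htotal)
  by_cases hi : Integrable fun x => f x t
  · exact (ofReal_integral_eq_lintegral_ofReal hi (ae_of_all _ fun x => h0 x t)).le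
  · simp [integral_undef hi]

/-- Truncation of time to `[0, T]`. -/
def clampTime (T t : ℝ) : ℝ := max 0 (min T t)

theorem continuous_clampTime (T : ℝ) : Continuous (clampTime T) := by
  unfold clampTime
  fun_prop

theorem clampTime_mem {T : ℝ} (hT : 0 ≤ T) (t : ℝ) : clampTime T t ∈ Icc 0 T :=
  ⟨le_max_left _ _, max_le hT (min_le_left _ _)⟩

theorem clampTime_of_mem {T t : ℝ} (ht : t ∈ Icc 0 T) : clampTime T t = t := by
  rw [clampTime, min_eq_right ht.2, max_eq_right ht.1]

theorem continuous_clamp {E : Type*} [TopologicalSpace E] {T : ℝ} (hT : 0 ≤ T) {f : ℝ → ℝ → E}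
    (hf : ContinuousOn (fun p : ℝ × ℝ => f p.1 p.2) (univ ×ˢ Icc 0 T)) :
    Continuous fun p : ℝ × ℝ => f p.1 (clampTime T p.2) :=
  hf.comp_continuous (f := fun p : ℝ × ℝ => (p.1, clampTime T p.2))
    (continuous_fst.prodMk ((continuous_clampTime T).comp continuous_snd))
    fun p => ⟨mem_univ _, clampTime_mem hT p.2⟩

theorem hasDerivAt_clamp {E : Type*} [NormedAddCommGroup E] [NormedSpace ℝ E]
    {f : ℝ → ℝ → E} {x T t : ℝ} (ht : t ∈ Ioo 0 T)
    (hf : DifferentiableWithinAt ℝ (fun s => f x s) (Icc 0 T) t) :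
    HasDerivAt (fun s => f x (clampTime T s)) (pdt T f x (clampTime T t)) t := by
  have h := hf.hasDerivWithinAt.hasDerivAt (Icc_mem_nhds ht.1 ht.2)
  rw [clampTime_of_mem ⟨ht.1.le, ht.2.le⟩]
  refine h.congr_of_eventuallyEq ?_
  filter_upwards [Icc_mem_nhds ht.1 ht.2] with s hs
  rw [clampTime_of_mem hs]

theorem tendsto_clamp {f : ℝ → ℝ → ℝ} {T c : ℝ} (hT : 0 ≤ T)
    (h : ∀ ε > 0, ∃ M : ℝ, ∀ x : ℝ, ∀ t ∈ Icc (0:ℝ) T, M ≤ |x| → |f x t - c| < ε) :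
    Tendsto (fun p : ℝ × ℝ => f p.1 (clampTime T p.2)) (cocompact ℝ ×ˢ ⊤) (nhds c) := by
  refine Metric.tendsto_nhds.2 fun ε hε => ?_
  obtain ⟨M, hM⟩ := h ε hε
  have h1 : ∀ᶠ x : ℝ in cocompact ℝ, M ≤ |x| :=
    tendsto_norm_cocompact_atTop.eventually (eventually_ge_atTop M)
  refine (h1.prod_inl ⊤).mono fun p hp => ?_
  exact hM p.1 _ (clampTime_mem hT p.2) hp

theorem HasDerivAt.prod_fst {f : ℝ → ℝ × ℝ} {f' : ℝ × ℝ} {x : ℝ} (h : HasDerivAt f f' x) :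
    HasDerivAt (fun y => (f y).1) f'.1 x :=
  (ContinuousLinearMap.fst ℝ ℝ ℝ).hasFDerivAt.comp_hasDerivAt x h

theorem HasDerivAt.prod_snd {f : ℝ → ℝ × ℝ} {f' : ℝ × ℝ} {x : ℝ} (h : HasDerivAt f f' x) :
    HasDerivAt (fun y => (f y).2) f'.2 x :=
  (ContinuousLinearMap.snd ℝ ℝ ℝ).hasFDerivAt.comp_hasDerivAt x h

theorem abs_fst_le_sqrt_sq2 (p : ℝ × ℝ) : |p.1| ≤ √(sq2 p) :=
  Real.abs_le_sqrt (le_add_of_nonneg_right (sq_nonneg p.2))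

theorem abs_snd_le_sqrt_sq2 (p : ℝ × ℝ) : |p.2| ≤ √(sq2 p) :=
  Real.abs_le_sqrt (le_add_of_nonneg_left (sq_nonneg p.1))

theorem sq2_nonneg (p : ℝ × ℝ) : 0 ≤ sq2 p := add_nonneg (sq_nonneg _) (sq_nonneg _)

namespace IsClassicalSolution

variable {α β T t : ℝ} {v u θ : ℝ → ℝ → ℝ} {w b : ℝ → ℝ → ℝ × ℝ}

theorem dx_v (h : IsClassicalSolution α β T v u θ w b) (ht : t ∈ Icc 0 T) (x : ℝ) :
    HasDerivAt (fun y => v y t) (pdx v x t) x :=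
  (h.diff_x x t ht).1.hasDerivAt

theorem dx_u (h : IsClassicalSolution α β T v u θ w b) (ht : t ∈ Icc 0 T) (x : ℝ) :
    HasDerivAt (fun y => u y t) (pdx u x t) x :=
  (h.diff_x x t ht).2.1.hasDerivAt

theorem dx_θ (h : IsClassicalSolution α β T v u θ w b) (ht : t ∈ Icc 0 T) (x : ℝ) :
    HasDerivAt (fun y => θ y t) (pdx θ x t) x :=
  (h.diff_x x t ht).2.2.1.hasDerivAt

theorem dx_w (h : IsClassicalSolution α β T v u θ w b) (ht : t ∈ Icc 0 T) (x : ℝ) :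
    HasDerivAt (fun y => w y t) (pdx w x t) x :=
  (h.diff_x x t ht).2.2.2.1.hasDerivAt

theorem dx_b (h : IsClassicalSolution α β T v u θ w b) (ht : t ∈ Icc 0 T) (x : ℝ) :
    HasDerivAt (fun y => b y t) (pdx b x t) x :=
  (h.diff_x x t ht).2.2.2.2.hasDerivAt

theorem momentum (h : IsClassicalSolution α β T v u θ w b) (ht : t ∈ Icc 0 T) (x : ℝ) :
    HasDerivAt (fun y => visc α (v y t) * pdx u y t / v y t
    - (θ y t / v y t + ((b y t).1 ^ 2 + (b y t).2 ^ 2) / 2)) (pdt T u x t) x := by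
  have hv := (h.dx_v ht x).differentiableAt
  have hv0 := (h.v_pos x t ht).ne'
  have hb := (h.dx_b ht x).differentiableAt
  have h1 : DifferentiableAt ℝ (fun y => visc α (v y t) * pdx u y t / v y t) x :=
    ((((hv.rpow_const (Or.inl hv0)).const_mul α).const_add 1).fun_mul (h.diff_xx x t ht).1).fun_div
      hv hv0
  have h2 : DifferentiableAt ℝ (fun y => θ y t / v y t + ((b y t).1 ^ 2 + (b y t).2 ^ 2) / 2) x :=
    ((h.dx_θ ht x).differentiableAt.fun_div hv hv0).fun_add
      (((hb.fst.fun_pow 2).fun_add (hb.snd.fun_pow 2)).div_const 2)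
  refine (h1.hasDerivAt.fun_sub h2.hasDerivAt).congr_deriv ?_
  have := h.eq_mom x t ht
  simp only [pdx, sq2] at this ⊢
  linarith

theorem transverse (h : IsClassicalSolution α β T v u θ w b) (ht : t ∈ Icc 0 T) (x : ℝ) :
    HasDerivAt (fun y => (v y t)⁻¹ • pdx w y t + b y t) (pdt T w x t) x := by
  have h1 : DifferentiableAt ℝ (fun y => (v y t)⁻¹ • pdx w y t) x :=
    ((h.dx_v ht x).differentiableAt.fun_inv (h.v_pos x t ht).ne').fun_smul
      (h.diff_xx x t ht).2.2.1
  refine (h1.hasDerivAt.fun_add (h.dx_b ht x)).congr_deriv ?_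
  exact (sub_eq_iff_eq_add.1 (h.eq_w x t ht)).symm

theorem magnetic (h : IsClassicalSolution α β T v u θ w b) (ht : t ∈ Icc 0 T) (x : ℝ) :
    HasDerivAt (fun y => (v y t)⁻¹ • pdx b y t + w y t)
      (pdx u x t • b x t + v x t • pdt T b x t) x := by
  have h1 : DifferentiableAt ℝ (fun y => (v y t)⁻¹ • pdx b y t) x :=
    ((h.dx_v ht x).differentiableAt.fun_inv (h.v_pos x t ht).ne').fun_smul
      (h.diff_xx x t ht).2.2.2
  refine (h1.hasDerivAt.fun_add (h.dx_w ht x)).congr_deriv ?_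
  have h2 : pdt T (fun y s => v y s • b y s) x t = v x t • pdt T b x t + pdt T v x t • b x t :=
    derivWithin_fun_smul (h.diff_t x t ht).1 (h.diff_t x t ht).2.2.2.2
  rw [← h.eq_mass x t ht, add_comm (pdt T v x t • b x t), ← h2]
  exact (sub_eq_iff_eq_add.1 (h.eq_b x t ht)).symm

theorem temperature (h : IsClassicalSolution α β T v u θ w b) (ht : t ∈ Icc 0 T) (x : ℝ) :
    HasDerivAt (fun y => θ y t ^ β * pdx θ y t / v y t)
    (pdt T θ x t + θ x t / v x t * pdx u x t
      - (visc α (v x t) * pdx u x t ^ 2 + ((pdx w x t).1 ^ 2 + (pdx w x t).2 ^ 2)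
        + ((pdx b x t).1 ^ 2 + (pdx b x t).2 ^ 2)) / v x t) x := by
  have h1 : DifferentiableAt ℝ (fun y => θ y t ^ β * pdx θ y t / v y t) x :=
    (((h.dx_θ ht x).differentiableAt.rpow_const (Or.inl (h.θ_pos x t ht).ne')).fun_mul
      (h.diff_xx x t ht).2.1).fun_div (h.dx_v ht x).differentiableAt (h.v_pos x t ht).ne'
  exact h1.hasDerivAt.congr_deriv (eq_sub_of_add_eq (h.eq_temp x t ht).symm)

end IsClassicalSolution

/-- Extension of a classical solution to all times by truncating time to `[0, T]`. -/
def IsClassicalSolution.toFlow {α β T K δ : ℝ} {v u θ : ℝ → ℝ → ℝ} {w b : ℝ → ℝ → ℝ × ℝ}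
    (h : IsClassicalSolution α β T v u θ w b) (ha : Admissible K δ v u θ w b) (hT : 0 ≤ T) :
    MHDFlow α β T K δ where
  v x t := v x (clampTime T t)
  u x t := u x (clampTime T t)
  θ x t := θ x (clampTime T t)
  w₁ x t := (w x (clampTime T t)).1
  w₂ x t := (w x (clampTime T t)).2
  b₁ x t := (b x (clampTime T t)).1
  b₂ x t := (b x (clampTime T t)).2
  vx x t := pdx v x (clampTime T t)
  ux x t := pdx u x (clampTime T t)
  θx x t := pdx θ x (clampTime T t)
  w₁x x t := (pdx w x (clampTime T t)).1
  w₂x x t := (pdx w x (clampTime T t)).2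
  b₁x x t := (pdx b x (clampTime T t)).1
  b₂x x t := (pdx b x (clampTime T t)).2
  ut x t := pdt T u x (clampTime T t)
  θt x t := pdt T θ x (clampTime T t)
  w₁t x t := (pdt T w x (clampTime T t)).1
  w₂t x t := (pdt T w x (clampTime T t)).2
  b₁t x t := (pdt T b x (clampTime T t)).1
  b₂t x t := (pdt T b x (clampTime T t)).2
  continuous_v := continuous_clamp hT h.cont.fst
  continuous_u := continuous_clamp hT h.cont.snd.fst
  continuous_θ := continuous_clamp hT h.cont.snd.snd.fst
  continuous_w₁ := (continuous_clamp hT h.cont.snd.snd.snd.fst).fst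
  continuous_w₂ := (continuous_clamp hT h.cont.snd.snd.snd.fst).snd
  continuous_b₁ := (continuous_clamp hT h.cont.snd.snd.snd.snd).fst
  continuous_b₂ := (continuous_clamp hT h.cont.snd.snd.snd.snd).snd
  continuous_vx := continuous_clamp hT h.cont_dx.fst
  continuous_ux := continuous_clamp hT h.cont_dx.snd.fst
  continuous_θx := continuous_clamp hT h.cont_dx.snd.snd.fst
  continuous_w₁x := (continuous_clamp hT h.cont_dx.snd.snd.snd.fst).fst
  continuous_w₂x := (continuous_clamp hT h.cont_dx.snd.snd.snd.fst).snd
  continuous_b₁x := (continuous_clamp hT h.cont_dx.snd.snd.snd.snd).fst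
  continuous_b₂x := (continuous_clamp hT h.cont_dx.snd.snd.snd.snd).snd
  continuous_ut := continuous_clamp hT h.cont_dt.snd.fst
  continuous_θt := continuous_clamp hT h.cont_dt.snd.snd.fst
  continuous_w₁t := (continuous_clamp hT h.cont_dt.snd.snd.snd.fst).fst
  continuous_w₂t := (continuous_clamp hT h.cont_dt.snd.snd.snd.fst).snd
  continuous_b₁t := (continuous_clamp hT h.cont_dt.snd.snd.snd.snd).fst
  continuous_b₂t := (continuous_clamp hT h.cont_dt.snd.snd.snd.snd).snd
  v_pos x t := h.v_pos x _ (clampTime_mem hT t)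
  θ_pos x t := h.θ_pos x _ (clampTime_mem hT t)
  dx_v x t := h.dx_v (clampTime_mem hT t) x
  dx_u x t := h.dx_u (clampTime_mem hT t) x
  dx_θ x t := h.dx_θ (clampTime_mem hT t) x
  dx_w₁ x t := (h.dx_w (clampTime_mem hT t) x).prod_fst
  dx_w₂ x t := (h.dx_w (clampTime_mem hT t) x).prod_snd
  dx_b₁ x t := (h.dx_b (clampTime_mem hT t) x).prod_fst
  dx_b₂ x t := (h.dx_b (clampTime_mem hT t) x).prod_snd
  dt_v x t ht := (hasDerivAt_clamp ht (h.diff_t x t (Ioo_subset_Icc_self ht)).1).congr_deriv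
    (h.eq_mass x _ (clampTime_mem hT t))
  dt_u x t ht := hasDerivAt_clamp ht (h.diff_t x t (Ioo_subset_Icc_self ht)).2.1
  dt_θ x t ht := hasDerivAt_clamp ht (h.diff_t x t (Ioo_subset_Icc_self ht)).2.2.1
  dt_w₁ x t ht := (hasDerivAt_clamp ht (h.diff_t x t (Ioo_subset_Icc_self ht)).2.2.2.1).prod_fst
  dt_w₂ x t ht := (hasDerivAt_clamp ht (h.diff_t x t (Ioo_subset_Icc_self ht)).2.2.2.1).prod_snd
  dt_b₁ x t ht := (hasDerivAt_clamp ht (h.diff_t x t (Ioo_subset_Icc_self ht)).2.2.2.2).prod_fst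
  dt_b₂ x t ht := (hasDerivAt_clamp ht (h.diff_t x t (Ioo_subset_Icc_self ht)).2.2.2.2).prod_snd
  far_v := tendsto_clamp hT fun ε hε => (h.farfield ε hε).imp fun _ hM x t ht hx =>
    (hM x t ht hx).1
  far_u := tendsto_clamp hT fun ε hε => (h.farfield ε hε).imp fun _ hM x t ht hx => by
    rw [sub_zero]
    exact (hM x t ht hx).2.1
  far_θ := tendsto_clamp hT fun ε hε => (h.farfield ε hε).imp fun _ hM x t ht hx =>
    (hM x t ht hx).2.2.1
  far_w₁ := tendsto_clamp (f := fun x t => (w x t).1) hT fun ε hε =>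
    (h.farfield ε hε).imp fun _ hM x t ht hx => by
      rw [sub_zero]
      exact (abs_fst_le_sqrt_sq2 _).trans_lt (hM x t ht hx).2.2.2.2
  far_w₂ := tendsto_clamp (f := fun x t => (w x t).2) hT fun ε hε =>
    (h.farfield ε hε).imp fun _ hM x t ht hx => by
      rw [sub_zero]
      exact (abs_snd_le_sqrt_sq2 _).trans_lt (hM x t ht hx).2.2.2.2
  far_b₁ := tendsto_clamp (f := fun x t => (b x t).1) hT fun ε hε =>
    (h.farfield ε hε).imp fun _ hM x t ht hx => by
      rw [sub_zero]
      exact (abs_fst_le_sqrt_sq2 _).trans_lt (hM x t ht hx).2.2.2.1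
  far_b₂ := tendsto_clamp (f := fun x t => (b x t).2) hT fun ε hε =>
    (h.farfield ε hε).imp fun _ hM x t ht hx => by
      rw [sub_zero]
      exact (abs_snd_le_sqrt_sq2 _).trans_lt (hM x t ht hx).2.2.2.1
  momentum x t := h.momentum (clampTime_mem hT t) x
  transverse₁ x t := by
    simpa [div_eq_inv_mul] using (h.transverse (clampTime_mem hT t) x).prod_fst
  transverse₂ x t := by
    simpa [div_eq_inv_mul] using (h.transverse (clampTime_mem hT t) x).prod_snd
  magnetic₁ x t := by
    simpa [div_eq_inv_mul] using (h.magnetic (clampTime_mem hT t) x).prod_fst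
  magnetic₂ x t := by
    simpa [div_eq_inv_mul] using (h.magnetic (clampTime_mem hT t) x).prod_snd
  temperature x t := h.temperature (clampTime_mem hT t) x
  initial R hR := by
    have h0 : (0:ℝ) ∈ Icc 0 T := ⟨le_rfl, hT⟩
    obtain ⟨iv, iu, iθ, ib, iw, ivx, iux, iθx, ibx, iwx⟩ := h.sq_int 0 h0
    rw [clampTime_of_mem h0, intervalIntegral.integral_of_le (by linarith)]
    have h1 := ((((iv.add iu).add iθ).add ib).add iw).add ivx
    refine (setIntegral_le_integral h1 (ae_of_all _ fun x => ?_)).trans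
      (le_trans (integral_mono h1 ((((h1.add iux).add iθx).add ibx).add iwx) fun x => ?_) ha.1)
    · have := sq2_nonneg (b x 0)
      have := sq2_nonneg (w x 0)
      simp only [Pi.zero_apply, Pi.add_apply]
      positivity
    · have := sq2_nonneg (pdx b x 0)
      have := sq2_nonneg (pdx w x 0)
      have := sq_nonneg (pdx u x 0)
      have := sq_nonneg (pdx θ x 0)
      simp only [Pi.add_apply]
      linarith
  v_initial x := by
    rw [clampTime_of_mem ⟨le_rfl, hT⟩]
    exact ha.2.1 x
  θ_initial x := by
    rw [clampTime_of_mem ⟨le_rfl, hT⟩]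
    exact ha.2.2 x

/-- Lemma 2.4 of the paper: space-time bound for `u_x² + θ⁻¹θ_x²`. -/
theorem ux_thetax_space_time_bound (α β T K δ : ℝ) (hα : 0 ≤ α) (hβ : 0 < β) (hT : 0 < T)
    (hK : 0 < K) (hδ₀ : 0 < δ) (hδ₁ : δ ≤ 1) :
    ∃ C : ℝ, 0 < C ∧
      ∀ (v u θ : ℝ → ℝ → ℝ) (w b : ℝ → ℝ → ℝ × ℝ),
        IsClassicalSolution α β T v u θ w b → Admissible K δ v u θ w b →
        (∫ t in (0:ℝ)..T, ∫ x : ℝ,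
          ((pdx u x t) ^ 2 + (θ x t)⁻¹ * (pdx θ x t) ^ 2)) ≤ C := by

  obtain ⟨C, hC, h⟩ := MHDFlow.exists_integral_gradient_le α β T K δ hα hβ hT hδ₀ hδ₁
  refine ⟨C, hC, fun v u θ w b hs ha => ?_⟩
  let S := hs.toFlow ha hT.le
  have h1 := integral_integral_line_le
    (f := fun x t => S.ux x t ^ 2 + (S.θ x t)⁻¹ * S.θx x t ^ 2)
    (by fun_prop (disch := intros; simp))
    (fun x t => by have := S.θ_pos x t; positivity) hT.le (h S)
  refine (intervalIntegral.integral_congr fun t ht => ?_).trans_le h1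
  rw [uIcc_of_le hT.le] at ht
  simp only [S, IsClassicalSolution.toFlow, clampTime_of_mem ht]
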